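/- The group Q_{4,2} is presented by the generators x, y and the relations: y³ = 1; [x², yxy] = 1; x⁴ = 1 and b_i⁴ = 1 for every integer i ≥ 1; [x, b_i] = b_i² for every integer i ≥ 1; and [b_i, b_j] = b_i²·b_{j−i}²·b_j² for all 1 ≤ i < j; where b_i denotes the word [x, (yxy)^{−i}]. Precisely, the homomorphism from the free group on two generators x, y onto Q_{4,2} sending x ↦ p(X) and y ↦ p(Y) is surjective with kernel the normal closure of the corresponding set of relators. -/

import Mathlib

/-!
Common setup: the commutator convention `[a,b] = a⁻¹b⁻¹ab` of the paper, the sequence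
`x₀ = x`, `x_{i+1} = [yxy, x_i]`, the Laurent polynomial ring `R = 𝔽₂[t,t⁻¹]`, and the
images `X`, `Y` of `σ₁σ₂σ₃` and `σ₁σ₂σ₃σ₁` in `GL(3, R)` under the mod-2 reduced Burau
representation of the 4-strand braid group.
-/

open Matrix LaurentPolynomial

noncomputable section

set_option maxRecDepth 100000

/-- The paper's commutator convention: `[a,b] = a⁻¹b⁻¹ab`. -/
def br {G : Type*} [Group G] (a b : G) : G := a⁻¹ * b⁻¹ * a * b

/-- The recursively defined elements `x₀ = x`, `x_{i+1} = [yxy, x_i]`. -/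
def xseq {G : Type*} [Group G] (x y : G) : ℕ → G
  | 0 => x
  | n + 1 => br (y * x * y) (xseq x y n)

/-- `R = 𝔽₂[t,t⁻¹]`, the ring of Laurent polynomials over the field with two elements. -/
abbrev R2 : Type := LaurentPolynomial (ZMod 2)

instance : CharP R2 2 := charP_of_injective_algebraMap (algebraMap (ZMod 2) R2).injective 2

/-- The matrix `X = t·!![0,0,1; 1,0,1; 0,1,1]`. -/
def Xmat : Matrix (Fin 3) (Fin 3) R2 := (T 1 : R2) • !![0,0,1; 1,0,1; 0,1,1]

/-- The matrix `Y = t·!![0,0,1; t,1,1; 0,1,1]`. -/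
def Ymat : Matrix (Fin 3) (Fin 3) R2 := (T 1 : R2) • !![0,0,1; T 1,1,1; 0,1,1]

/-- An explicit inverse for `Xmat`. -/
def Xmatinv : Matrix (Fin 3) (Fin 3) R2 := (T (-1) : R2) • !![1,1,0; 1,0,1; 1,0,0]

/-- An explicit inverse for `Ymat`. -/
def Ymatinv : Matrix (Fin 3) (Fin 3) R2 := (T (-2) : R2) • !![0,1,1; T 1,0,T 1; T 1,0,0]

lemma Xmat_mul_Xmatinv : Xmat * Xmatinv = 1 := by
  rw [Xmat, Xmatinv, Matrix.smul_mul, Matrix.mul_smul, smul_smul, ← T_add]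
  simp only [Matrix.mul_fin_three, mul_zero, zero_mul, mul_one, one_mul, add_zero, zero_add,
    ← T_add, CharTwo.add_self_eq_zero]
  rw [Matrix.one_fin_three]
  simp only [Matrix.smul_of, Matrix.smul_cons, smul_eq_mul, Matrix.smul_empty, ← T_add,
    mul_zero, mul_one]
  norm_num [T_zero]

lemma Xmatinv_mul_Xmat : Xmatinv * Xmat = 1 := by
  rw [Xmat, Xmatinv, Matrix.smul_mul, Matrix.mul_smul, smul_smul, ← T_add]
  simp only [Matrix.mul_fin_three, mul_zero, zero_mul, mul_one, one_mul, add_zero, zero_add,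
    ← T_add, CharTwo.add_self_eq_zero]
  rw [Matrix.one_fin_three]
  simp only [Matrix.smul_of, Matrix.smul_cons, smul_eq_mul, Matrix.smul_empty, ← T_add,
    mul_zero, mul_one]
  norm_num [T_zero]

lemma Ymat_mul_Ymatinv : Ymat * Ymatinv = 1 := by
  rw [Ymat, Ymatinv, Matrix.smul_mul, Matrix.mul_smul, smul_smul, ← T_add]
  simp only [Matrix.mul_fin_three, mul_zero, zero_mul, mul_one, one_mul, add_zero, zero_add,
    ← T_add, CharTwo.add_self_eq_zero]
  rw [Matrix.one_fin_three]
  simp only [Matrix.smul_of, Matrix.smul_cons, smul_eq_mul, Matrix.smul_empty, ← T_add,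
    mul_zero, mul_one]
  norm_num [T_zero]

lemma Ymatinv_mul_Ymat : Ymatinv * Ymat = 1 := by
  rw [Ymat, Ymatinv, Matrix.mul_smul, Matrix.smul_mul, smul_smul, ← T_add]
  simp only [Matrix.mul_fin_three, mul_zero, zero_mul, mul_one, one_mul, add_zero, zero_add,
    ← T_add, CharTwo.add_self_eq_zero]
  rw [Matrix.one_fin_three]
  simp only [Matrix.smul_of, Matrix.smul_cons, smul_eq_mul, Matrix.smul_empty, ← T_add,
    mul_zero, mul_one]
  norm_num [T_zero]

/-- `X ∈ GL(3, 𝔽₂[t,t⁻¹])`, the mod-2 reduced Burau image of `σ₁σ₂σ₃`. -/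
def X : GL (Fin 3) R2 := ⟨Xmat, Xmatinv, Xmat_mul_Xmatinv, Xmatinv_mul_Xmat⟩

/-- `Y ∈ GL(3, 𝔽₂[t,t⁻¹])`, the mod-2 reduced Burau image of `σ₁σ₂σ₃σ₁`. -/
def Y : GL (Fin 3) R2 := ⟨Ymat, Ymatinv, Ymat_mul_Ymatinv, Ymatinv_mul_Ymat⟩

/-- `PGL(3, R)`, the projective general linear group: `GL(3,R)` modulo its center
(the subgroup of scalars). -/
abbrev PGL3 : Type := GL (Fin 3) R2 ⧸ Subgroup.center (GL (Fin 3) R2)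

/-- The natural projection `p : GL(3,R) → PGL(3,R)`. -/
def pp : GL (Fin 3) R2 →* PGL3 := QuotientGroup.mk' (Subgroup.center (GL (Fin 3) R2))

/-- `Q_{4,2}`, the subgroup of `PGL(3,R)` generated by `p(X)` and `p(Y)`. -/
abbrev Q42 : Subgroup PGL3 := Subgroup.closure {pp X, pp Y}

/-- The generator `x` of the free group on `x, y`. -/
def fx : FreeGroup (Fin 2) := FreeGroup.of 0

/-- The generator `y` of the free group on `x, y`. -/
def fy : FreeGroup (Fin 2) := FreeGroup.of 1

/-- The word `b_i = [x, (yxy)^{-i}]`, for `i ≥ 1`. -/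
def bwd (i : ℕ) : FreeGroup (Fin 2) := br fx ((fy * fx * fy) ^ (-(i : ℤ)))

/-- The relators of Theorem A.5: `y³`; `[x², yxy]`; `x⁴` and `b_i⁴` for `i ≥ 1`;
`[x, b_i] = b_i²` for `i ≥ 1`; and `[b_i, b_j] = b_i²·b_{j-i}²·b_j²` for `1 ≤ i < j`. -/
def q42RelsB : Set (FreeGroup (Fin 2)) :=
  {fy ^ 3, br (fx ^ 2) (fy * fx * fy), fx ^ 4} ∪
    {r | ∃ i : ℕ, 1 ≤ i ∧ r = bwd i ^ 4} ∪
    {r | ∃ i : ℕ, 1 ≤ i ∧ r = br fx (bwd i) * (bwd i ^ 2)⁻¹} ∪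
    {r | ∃ i j : ℕ, 1 ≤ i ∧ i < j ∧
      r = br (bwd i) (bwd j) * (bwd i ^ 2 * bwd (j - i) ^ 2 * bwd j ^ 2)⁻¹}

set_option linter.all false

lemma coeff_T_mul (k i : ℤ) (p : R2) : (T k * p).coeff i = p.coeff (i - k) := by
  rw [show (T k : R2) = AddMonoidAlgebra.single k 1 from rfl,
    AddMonoidAlgebra.coeff_single_mul_eq_mul_coeff (m₂ := i - k)]
  · simp
  · intro a _; constructor <;> intro h <;> omega

lemma coeff_add' (p q : R2) (i : ℤ) : (p + q).coeff i = p.coeff i + q.coeff i := by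
  rw [AddMonoidAlgebra.coeff_add]; rfl

lemma zm2 {a : ZMod 2} (h : a ≠ 0) : a = 1 := by
  revert a; decide

lemma T_ne (k : ℤ) : (T k : R2) ≠ 0 := by
  intro h
  have := congrArg (fun p : R2 => p.coeff k) h
  simp [T_apply] at this

lemma TT (a b : ℤ) (p : R2) : T a * (T b * p) = T (a + b) * p := by
  rw [T_add, mul_assoc]

lemma T_inj {a b : ℤ} (h : (T a : R2) = T b) : a = b := by
  have := congrArg (fun p : R2 => p.coeff a) h
  simp [T_apply] at this
  exact this.symm

/-- support contained in `[a,b]` -/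
def Sup (p : R2) (a b : ℤ) : Prop := ∀ i, p.coeff i ≠ 0 → a ≤ i ∧ i ≤ b

lemma Sup.mono {p : R2} {a b c d : ℤ} (h : Sup p a b) (h1 : c ≤ a) (h2 : b ≤ d) : Sup p c d :=
  fun i hi => ⟨h1.trans (h i hi).1, (h i hi).2.trans h2⟩

lemma Sup.zero_of {p : R2} {a b : ℤ} (h : Sup p a b) {i : ℤ} (hi : ¬ (a ≤ i ∧ i ≤ b)) :
    p.coeff i = 0 := by
  by_contra hc; exact hi (h i hc)

lemma Sup.add {p q : R2} {a b : ℤ} (h : Sup p a b) (h' : Sup q a b) : Sup (p + q) a b := by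
  intro i hi
  by_contra hc
  apply hi
  rw [coeff_add', h.zero_of hc, h'.zero_of hc, add_zero]

lemma Sup.T_mul {p : R2} {a b : ℤ} (k : ℤ) (h : Sup p a b) : Sup (T k * p) (a + k) (b + k) := by
  intro i hi
  rw [coeff_T_mul] at hi
  have := h _ hi
  omega

lemma Sup.T_mul' {p : R2} {a b c d : ℤ} (k : ℤ) (h : Sup p a b) (h1 : c ≤ a + k) (h2 : b + k ≤ d) :
    Sup (T k * p) c d := (h.T_mul k).mono h1 h2

lemma Sup.inv {p : R2} {a b : ℤ} (h : Sup p a b) : Sup (invert p) (-b) (-a) := by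
  intro i hi
  rw [invert_apply] at hi
  have := h _ hi
  omega

lemma Sup.mul {p q : R2} {a b c d : ℤ} (h : Sup p a b) (h' : Sup q c d) :
    Sup (p * q) (a + c) (b + d) := by
  intro i hi
  by_contra hc
  apply hi
  rw [AddMonoidAlgebra.coeff_mul]
  apply Finset.sum_eq_zero
  intro u hu
  apply Finset.sum_eq_zero
  intro v hv
  have h1 := h u (by simpa using hu)
  have h2 := h' v (by simpa using hv)
  show (if u + v = i then _ else _) = (0 : ZMod 2)
  rw [if_neg]; omega

lemma coeff_mul_top {p q : R2} {a b c d : ℤ} (h : Sup p a b) (h' : Sup q c d) :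
    (p * q).coeff (b + d) = p.coeff b * q.coeff d := by
  rw [AddMonoidAlgebra.coeff_mul]
  unfold Finsupp.sum
  beta_reduce
  rw [Finset.sum_eq_single b, Finset.sum_eq_single d]
  · simp
  · intro v hv hne
    rw [if_neg]; omega
  · intro hd
    simp at hd; simp [hd]
  · intro u hu hne
    apply Finset.sum_eq_zero
    intro v hv
    have h1 := h u (by simpa using hu)
    have h2 := h' v (by simpa using hv)
    rw [if_neg]; omega
  · intro hd
    simp at hd; simp [hd]

lemma coeff_mul_bot {p q : R2} {a b c d : ℤ} (h : Sup p a b) (h' : Sup q c d) :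
    (p * q).coeff (a + c) = p.coeff a * q.coeff c := by
  have := coeff_mul_top h.inv h'.inv
  rw [← map_mul, invert_apply, invert_apply, invert_apply] at this
  simpa [add_comm] using this

lemma exists_sup (p : R2) : ∃ a b, Sup p a b := by
  refine ⟨-(p.coeff.support.sum fun i => |i|), p.coeff.support.sum fun i => |i|, ?_⟩
  intro i hi
  have := Finset.single_le_sum (f := fun i : ℤ => |i|) (fun i _ => abs_nonneg i)
    (Finsupp.mem_support_iff.2 hi)
  exact abs_le.1 this

lemma coeff_ne {p : R2} (hp : p ≠ 0) : p.coeff.support.Nonempty := by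
  by_contra hc
  apply hp
  rw [Finset.not_nonempty_iff_eq_empty, Finsupp.support_eq_empty] at hc
  apply LaurentPolynomial.ext
  intro a
  rw [hc]; rfl

lemma exists_ends {p : R2} (hp : p ≠ 0) :
    ∃ a b, a ≤ b ∧ Sup p a b ∧ p.coeff a = 1 ∧ p.coeff b = 1 := by
  have hne := coeff_ne hp
  refine ⟨p.coeff.support.min' hne, p.coeff.support.max' hne, ?_, ?_, ?_, ?_⟩
  · exact Finset.min'_le_max' _ hne
  · intro i hi
    have := Finsupp.mem_support_iff.2 hi
    exact ⟨Finset.min'_le _ _ this, Finset.le_max' _ _ this⟩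
  · exact zm2 (Finsupp.mem_support_iff.1 (Finset.min'_mem _ hne))
  · exact zm2 (Finsupp.mem_support_iff.1 (Finset.max'_mem _ hne))

lemma sup_zero (a b : ℤ) : Sup (0 : R2) a b := by
  intro i hi; exact absurd rfl hi

/-- the ends of `(1+t) q q̄` -/
lemma qq_ends {q : R2} {B C : ℤ} (h : Sup q B C) (hB : q.coeff B = 1) (hC : q.coeff C = 1) :
    ((1 + T 1) * (q * invert q)).coeff (C - B + 1) = 1 := by
  have h1 := h.mul h.inv
  have h2 := coeff_mul_top h h.inv
  rw [invert_apply] at h2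
  rw [add_mul, one_mul, coeff_add', coeff_T_mul]
  rw [h1.zero_of (by omega), show C - B + 1 - 1 = C + -B by ring, h2]
  simp [hB, hC]

/-- width bound: if `(1+t) q q̄` is supported in degrees `≤ W`, then width of q ≤ W - 1 -/
lemma width_le {q : R2} {B C W : ℤ} (h : Sup q B C) (hB : q.coeff B = 1) (hC : q.coeff C = 1)
    {V : ℤ} (hs : Sup ((1 + T 1) * (q * invert q)) V W) : C - B + 1 ≤ W := by
  have := qq_ends h hB hC
  exact (hs _ (by rw [this]; decide)).2

lemma Sup.t1 {q : R2} {a b : ℤ} (h : Sup q a b) : Sup ((1 + T 1) * q) a (b + 1) := by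
  rw [add_mul, one_mul]
  exact (h.mono le_rfl (by omega)).add (h.T_mul' 1 (by omega) (by omega))

lemma t1_coeff (q : R2) (i : ℤ) : ((1 + T 1) * q).coeff i = q.coeff i + q.coeff (i - 1) := by
  rw [add_mul, one_mul, coeff_add', coeff_T_mul]

lemma one_t_ne : (1 + T 1 : R2) ≠ 0 := by
  intro h
  have := congrArg (fun p : R2 => p.coeff 1) h
  rw [show (1 : R2) = T 0 from T_zero.symm] at this
  simp only [coeff_add', T_apply] at this
  simp at this


abbrev M3 : Type := R2 × R2 × R2

lemma hts : (T 1 : R2) * T (-1) = 1 := by rw [← T_add]; simp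

def xE : M3 ≃ₗ[R2] M3 where
  toFun u := (u.1 + (1 + T 1) * u.2.1 + T 1 * u.2.2, u.2.1 + u.2.2, u.2.2)
  invFun u := (u.1 + (1 + T 1) * u.2.1 + u.2.2, u.2.1 + u.2.2, u.2.2)
  map_add' u v := by ext1 <;> [skip; ext1] <;> simp <;> ring
  map_smul' c u := by ext1 <;> [skip; ext1] <;> simp <;> ring
  left_inv u := by ext1 <;> [skip; ext1] <;> simp <;> grind
  right_inv u := by ext1 <;> [skip; ext1] <;> simp <;> grind

def fE : M3 ≃ₗ[R2] M3 where
  toFun u := (u.2.2, u.2.1, T (-1) * u.1)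
  invFun u := (T 1 * u.2.2, u.2.1, u.1)
  map_add' u v := by ext1 <;> [skip; ext1] <;> simp <;> ring
  map_smul' c u := by ext1 <;> [skip; ext1] <;> simp <;> ring
  left_inv u := by have := hts; ext1 <;> [skip; ext1] <;> simp <;> grind
  right_inv u := by have := hts; ext1 <;> [skip; ext1] <;> simp <;> grind

def th : FreeGroup (Fin 2) →* (M3 ≃ₗ[R2] M3) := FreeGroup.lift ![xE, (xE * fE)⁻¹]

def ff : FreeGroup (Fin 2) := fx⁻¹ * fy⁻¹
def ww : FreeGroup (Fin 2) := fy * fx * fy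
def tau : FreeGroup (Fin 2) := ww * fx

lemma th_fx : th fx = xE := by simp [th, fx]
lemma th_fy : th fy = (xE * fE)⁻¹ := by simp [th, fy]
lemma th_ff : th ff = fE := by simp [ff, th_fx, th_fy]

lemma tau_eq : tau = ff⁻¹ * ff⁻¹ := by simp [tau, ww, ff, mul_assoc]
lemma tau_comm : tau * ff = ff * tau := by simp [tau_eq]
lemma ww_eq : ww = tau * fx⁻¹ := by simp [tau]

lemma x_act (p q r : R2) : th fx (p, q, r) = (p + (1 + T 1) * q + T 1 * r, q + r, r) := by
  rw [th_fx]; rfl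
lemma xi_act (p q r : R2) : th fx⁻¹ (p, q, r) = (p + (1 + T 1) * q + r, q + r, r) := by
  rw [map_inv, th_fx]; rfl
lemma f_act (p q r : R2) : th ff (p, q, r) = (r, q, T (-1) * p) := by
  rw [th_ff]; rfl
lemma fi_act (p q r : R2) : th ff⁻¹ (p, q, r) = (T 1 * r, q, p) := by
  rw [map_inv, th_ff]; rfl
lemma th_mul (a b : FreeGroup (Fin 2)) (u : M3) : th (a * b) u = th a (th b u) := by
  rw [map_mul]; rfl
lemma tau_act (p q r : R2) : th tau (p, q, r) = (T 1 * p, q, T 1 * r) := by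
  rw [tau_eq, th_mul, fi_act, fi_act]
lemma taui_act (p q r : R2) : th tau⁻¹ (p, q, r) = (T (-1) * p, q, T (-1) * r) := by
  rw [tau_eq, _root_.mul_inv_rev, inv_inv, th_mul, f_act, f_act]
lemma y_act (u : M3) : th fy u = th ff⁻¹ (th fx⁻¹ u) := by
  rw [← th_mul]; congr 2; simp [ff]

/-- intertwiner -/
def Bv (u : M3) : Fin 3 → R2 :=
  ![u.1 + T 1 * u.2.1 + u.2.2, (1 + T 1) * (u.2.1 + u.2.2), u.1 + u.2.1 + u.2.2]

lemma Bv_smul (c : R2) (u : M3) : Bv (c • u) = c • Bv u := by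
  funext i; fin_cases i <;> simp [Bv] <;> ring

lemma Bv_inj {u v : M3} (h : Bv u = Bv v) : u = v := by
  have h0 := congrFun h 0
  have h1 := congrFun h 1
  have h2 := congrFun h 2
  simp only [Bv, Matrix.cons_val] at h0 h1 h2
  have h1' := mul_left_cancel₀ one_t_ne h1
  have hq : u.2.1 = v.2.1 := by
    apply mul_left_cancel₀ one_t_ne
    grind
  ext1
  · grind
  ext1 <;> grind

abbrev LL : FreeGroup (Fin 2) →* GL (Fin 3) R2 := FreeGroup.lift ![X, Y]

lemma LL_x : LL fx = X := by simp [fx]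
lemma LL_y : LL fy = Y := by simp [fy]

lemma X_act (u : M3) : Xmat *ᵥ Bv u = (T 1 : R2) • Bv (th fx u) := by
  obtain ⟨p, q, r⟩ := u
  rw [x_act, Xmat, Matrix.smul_mulVec]
  congr 1
  funext i; fin_cases i <;> simp [Bv, Matrix.mulVec, dotProduct, Fin.sum_univ_three] <;> grind

lemma Y_act (u : M3) : Ymat *ᵥ Bv u = (T 1 : R2) • Bv (th fy u) := by
  obtain ⟨p, q, r⟩ := u
  rw [y_act, xi_act, fi_act, Ymat, Matrix.smul_mulVec]
  congr 1
  funext i; fin_cases i <;> simp [Bv, Matrix.mulVec, dotProduct, Fin.sum_univ_three] <;> grind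

lemma LL_act (g : FreeGroup (Fin 2)) :
    ∃ n : ℤ, ∀ u, (LL g).val *ᵥ Bv u = (T n : R2) • Bv (th g u) := by
  induction g using FreeGroup.induction_on with
  | C1 => exact ⟨0, fun u => by simp⟩
  | of i =>
    refine ⟨1, fun u => ?_⟩
    fin_cases i
    · exact LL_x ▸ X_act u
    · exact LL_y ▸ Y_act u
  | inv_of i ih =>
    obtain ⟨n, hn⟩ := ih
    refine ⟨-n, fun u => ?_⟩
    have h := hn (th (FreeGroup.of i)⁻¹ u)
    rw [← th_mul, mul_inv_cancel, map_one] at h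
    have h2 := congrArg (fun v => (T (-n) : R2) • ((LL (FreeGroup.of i)⁻¹).val *ᵥ v)) h
    simp only [Matrix.mulVec_mulVec, Matrix.mulVec_smul, smul_smul, ← T_add] at h2
    rw [← Units.val_mul, ← map_mul, inv_mul_cancel, map_one] at h2
    simp only [Units.val_one, Matrix.one_mulVec, neg_add_cancel, T_zero, one_smul] at h2
    exact h2.symm
  | mul a b ha hb =>
    obtain ⟨n, hn⟩ := ha
    obtain ⟨m, hm⟩ := hb
    refine ⟨n + m, fun u => ?_⟩
    rw [map_mul, Units.val_mul, ← Matrix.mulVec_mulVec, hm, Matrix.mulVec_smul, hn, smul_smul,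
      th_mul, ← T_add, add_comm]

lemma lift_eq (g : FreeGroup (Fin 2)) : FreeGroup.lift ![pp X, pp Y] g = pp (LL g) := by
  have : FreeGroup.lift ![pp X, pp Y] = pp.comp LL := by
    apply FreeGroup.ext_hom
    intro i
    fin_cases i <;> simp
  rw [this]; rfl

lemma pp_eq_one (A : GL (Fin 3) R2) : pp A = 1 ↔ ∃ c : R2, A.val = Matrix.scalar (Fin 3) c := by
  unfold pp
  rw [QuotientGroup.mk'_apply, QuotientGroup.eq_one_iff,
    Matrix.GeneralLinearGroup.mem_center_iff_val_mem_range_scalar]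
  constructor
  · rintro ⟨c, hc⟩; exact ⟨c, hc.symm⟩
  · rintro ⟨c, hc⟩; exact ⟨c, hc.symm⟩

lemma mulVec_Bv (A : Matrix (Fin 3) (Fin 3) R2) (p q r : R2) (i : Fin 3) :
    (A *ᵥ Bv (p, q, r)) i = A i 0 * (p + T 1 * q + r) + A i 1 * ((1 + T 1) * (q + r)) +
      A i 2 * (p + q + r) := by
  simp [Matrix.mulVec, dotProduct, Fin.sum_univ_three, Bv]

lemma ker_of_scalar {g : FreeGroup (Fin 2)} {m : ℤ} (h : ∀ u, th g u = (T m : R2) • u) :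
    FreeGroup.lift ![pp X, pp Y] g = 1 := by
  rw [lift_eq, pp_eq_one]
  obtain ⟨n, hn⟩ := LL_act g
  refine ⟨T n * T m, ?_⟩
  have key : ∀ u, ((LL g).val - Matrix.scalar (Fin 3) (T n * T m : R2)) *ᵥ Bv u = 0 := by
    intro u
    rw [Matrix.sub_mulVec, hn, h, Bv_smul, smul_smul, sub_eq_zero]
    funext i
    rw [Matrix.scalar_apply, Matrix.mulVec_diagonal, Pi.smul_apply, smul_eq_mul]
  set A := (LL g).val - Matrix.scalar (Fin 3) (T n * T m : R2) with hA
  have h0 := key (0, 1, 1)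
  have h1 := key (1, 0, 1)
  have h2 := key (1 + T 1, 1, 1)
  have hz : A = 0 := by
    clear_value A
    clear hn key h
    ext1 i j
    have e0 := congrFun h0 i
    have e1 := congrFun h1 i
    have e2 := congrFun h2 i
    rw [mulVec_Bv, Pi.zero_apply] at e0 e1 e2
    apply mul_left_cancel₀ one_t_ne
    rw [Matrix.zero_apply, mul_zero]
    have a0 : (1 + T 1) * A i 0 = 0 := by grind
    have a1 : (1 + T 1) * A i 1 = 0 := by grind
    have a2 : (1 + T 1) * A i 2 = 0 := by grind
    fin_cases j <;> assumption
  exact sub_eq_zero.1 hz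

lemma scalar_of_ker {g : FreeGroup (Fin 2)} (h : FreeGroup.lift ![pp X, pp Y] g = 1) :
    ∃ a : R2, ∀ u, th g u = a • u := by
  rw [lift_eq, pp_eq_one] at h
  obtain ⟨c, hc⟩ := h
  obtain ⟨n, hn⟩ := LL_act g
  refine ⟨T (-n) * c, fun u => ?_⟩
  apply Bv_inj
  rw [Bv_smul]
  have := hn u
  rw [hc] at this
  have h3 : Matrix.scalar (Fin 3) c *ᵥ Bv u = c • Bv u := by
    funext i; rw [Matrix.scalar_apply, Matrix.mulVec_diagonal, Pi.smul_apply, smul_eq_mul]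
  rw [h3] at this
  rw [← smul_smul, this, smul_smul, ← T_add]
  simp


section abs
variable {G : Type*} [Group G]

lemma perm_prod {ι : Type*} (F : ι → G) (C : Subgroup G)
    (hcomm : ∀ i j, ∃ c ∈ C, F i * F j = F j * F i * c)
    (hc : ∀ c ∈ C, ∀ i, c * F i = F i * c) {L L' : List ι} (h : L.Perm L') :
    ∃ c ∈ C, (L.map F).prod = (L'.map F).prod * c := by
  have hcl : ∀ c ∈ C, ∀ L : List ι, c * (L.map F).prod = (L.map F).prod * c := by
    intro c hcC L
    induction L with
    | nil => simp
    | cons a L ih =>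
      rw [List.map_cons, List.prod_cons, ← mul_assoc, hc c hcC, mul_assoc, ih, mul_assoc]
  induction h with
  | nil => exact ⟨1, C.one_mem, by simp⟩
  | cons a _ ih =>
    obtain ⟨c, h1, h2⟩ := ih
    exact ⟨c, h1, by simp [h2, mul_assoc]⟩
  | swap a b l =>
    obtain ⟨c, h1, h2⟩ := hcomm b a
    refine ⟨c, h1, ?_⟩
    simp only [List.map_cons, List.prod_cons]
    rw [← mul_assoc, h2, mul_assoc, hcl c h1, mul_assoc, mul_assoc, mul_assoc]
  | trans _ _ ih1 ih2 =>
    obtain ⟨c, h1, h2⟩ := ih1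
    obtain ⟨d, h3, h4⟩ := ih2
    exact ⟨d * c, C.mul_mem h3 h1, by rw [h2, h4, mul_assoc]⟩

lemma insert_prod {ι : Type*} [DecidableEq ι] (F : ι → G) (C : Subgroup G)
    (hcomm : ∀ i j, ∃ c ∈ C, F i * F j = F j * F i * c)
    (hc : ∀ c ∈ C, ∀ i, c * F i = F i * c) (hsq : ∀ i, F i * F i ∈ C) (i : ι)
    {L : List ι} (hL : L.Nodup) :
    ∃ L' : List ι, L'.Nodup ∧ ∃ c ∈ C, F i * (L.map F).prod = (L'.map F).prod * c := by
  by_cases hi : i ∈ L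
  · refine ⟨L.erase i, hL.erase i, ?_⟩
    obtain ⟨c, h1, h2⟩ := perm_prod F C hcomm hc (List.perm_cons_erase hi)
    obtain ⟨d, h3, h4⟩ := perm_prod F C hcomm hc (List.Perm.refl (L.erase i))
    have hcl : ∀ c ∈ C, ∀ L : List ι, c * (L.map F).prod = (L.map F).prod * c := by
      intro c hcC L
      induction L with
      | nil => simp
      | cons a L ih =>
        rw [List.map_cons, List.prod_cons, ← mul_assoc, hc c hcC, mul_assoc, ih, mul_assoc]
    refine ⟨(F i * F i) * c, C.mul_mem (hsq i) h1, ?_⟩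
    rw [h2, List.map_cons, List.prod_cons, ← mul_assoc, ← mul_assoc, hcl _ (hsq i), mul_assoc]
  · exact ⟨i :: L, List.nodup_cons.2 ⟨hi, hL⟩, 1, C.one_mem, by simp⟩

variable (x w : G)

def gX (i : ℤ) : G := w ^ i * x * w ^ (-i)
def gb (i : ℕ) : G := br x (w ^ (-(i : ℤ)))
def gz (i : ℕ) : G := if i = 0 then x ^ 2 else gb x w i ^ 2

lemma gb_eq (i : ℕ) : gb x w i = x⁻¹ * gX x w i := by
  simp [gb, gX, br, mul_assoc]

structure GRel : Prop where
  h0 : x ^ 2 * w = w * x ^ 2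
  h1 : x ^ 4 = 1
  h2 : ∀ i : ℕ, 1 ≤ i → gb x w i ^ 4 = 1
  h3 : ∀ i j : ℕ, 1 ≤ i → i < j →
    br (gb x w i) (gb x w j) = gb x w i ^ 2 * gb x w (j - i) ^ 2 * gb x w j ^ 2

variable {x w} (H : GRel x w)
include H

lemma gX_sq (i : ℤ) : gX x w i * gX x w i = x ^ 2 := by
  have : Commute (x ^ 2) (w ^ i) := Commute.zpow_right H.h0 i
  calc gX x w i * gX x w i = w ^ i * x ^ 2 * (w ^ i)⁻¹ := by simp [gX, pow_two, mul_assoc]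
    _ = x ^ 2 := by rw [← this.eq]; simp
lemma z_X (i : ℤ) : Commute (x ^ 2) (gX x w i) := by
  have h1 : Commute (x ^ 2) (w ^ i) := Commute.zpow_right H.h0 i
  have h2 : Commute (x ^ 2) x := (Commute.refl x).pow_left 2
  unfold gX
  rw [_root_.zpow_neg]
  exact (h1.mul_right h2).mul_right h1.inv_right
omit H
lemma aux1 {x a : G} (h : a * a = x ^ 2) : x⁻¹ * (x⁻¹ * a) * x = (x⁻¹ * a)⁻¹ := by
  have : x⁻¹ * (x⁻¹ * a) * x = (x ^ 2)⁻¹ * a * x := by group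
  rw [this, ← h]; group
lemma aux2 {x a : G} (h : a * a = x ^ 2) : x * a = a * x * (x⁻¹ * a) ^ 2 := by
  have h1 : a * x * (x⁻¹ * a) ^ 2 = a * a * x⁻¹ * a := by rw [pow_two]; group
  rw [h1, h]; group
lemma aux3 {x a b : G} (ha : a * a = x ^ 2) (hb : b * b = x ^ 2) (hz : Commute (x ^ 2) a) :
    a * b⁻¹ = a⁻¹ * b := by
  have h1 : b⁻¹ = (x ^ 2)⁻¹ * b := by rw [← hb]; group
  have h2 : a⁻¹ = a * (x ^ 2)⁻¹ := by rw [← ha]; group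
  rw [h1, h2]; group
lemma aux4 {a b Z : G} (ha : a ^ 4 = 1) (h : br a b = a ^ 2 * Z * b ^ 2) : (a * b⁻¹) ^ 2 = Z := by
  have : Z = (a ^ 2)⁻¹ * br a b * (b ^ 2)⁻¹ := by rw [h]; group
  rw [this, br]
  have h3 : (a ^ 2)⁻¹ * a⁻¹ = a := by
    have : a ^ 4 * ((a ^ 2)⁻¹ * a⁻¹) = a := by group
    rwa [ha, one_mul] at this
  calc (a * b⁻¹) ^ 2 = a * b⁻¹ * a * b⁻¹ := by rw [pow_two]; group
    _ = ((a ^ 2)⁻¹ * a⁻¹) * b⁻¹ * a * b⁻¹ := by rw [h3]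
    _ = _ := by group

include H
lemma x_zeta (m : ℕ) (hm : 1 ≤ m) : Commute x (gb x w m ^ 2) := by
  have h := aux1 (gX_sq H m)
  rw [← gb_eq] at h
  have h2 : x⁻¹ * gb x w m ^ 2 * x = gb x w m ^ 2 := by
    calc x⁻¹ * gb x w m ^ 2 * x = (x⁻¹ * gb x w m * x) ^ 2 := by rw [pow_two, pow_two]; group
      _ = (gb x w m ^ 4)⁻¹ * gb x w m ^ 2 := by rw [h]; group
      _ = _ := by rw [H.h2 m hm]; simp
  show x * _ = _ * x
  nth_rw 1 [← h2]; group

omit H in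
lemma w_X (i k : ℤ) : w ^ k * gX x w i = gX x w (i + k) * w ^ k := by
  unfold gX; group
lemma w_zeta (m : ℕ) (hm : 1 ≤ m) : Commute w (gb x w m ^ 2) := by
  have h := aux4 (H.h2 1 le_rfl) (H.h3 1 (m + 1) le_rfl (by omega))
  rw [Nat.add_sub_cancel] at h
  set Z := gb x w m ^ 2 with hZ
  have hx : Commute x Z := x_zeta H m hm
  rw [gb_eq, gb_eq] at h
  have h5 := aux3 (gX_sq H 1) (gX_sq H ((m + 1 : ℕ) : ℤ)) (z_X H 1)
  have h6 : x⁻¹ * gX x w (1 : ℕ) * (x⁻¹ * gX x w (m + 1 : ℕ))⁻¹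
      = x⁻¹ * (gX x w 1 * (gX x w ((m + 1 : ℕ) : ℤ))⁻¹) * x := by push_cast; group
  rw [h6, h5] at h
  have h7 : (gX x w 1)⁻¹ * gX x w ((m + 1 : ℕ) : ℤ) = w * gb x w m * w⁻¹ := by
    rw [gb_eq]; unfold gX; push_cast; group
  rw [h7] at h
  have h8 : x⁻¹ * (w * Z * w⁻¹) * x = Z := by
    refine Eq.trans ?_ h
    rw [hZ, pow_two, pow_two]; group
  have h9 : w * Z * w⁻¹ = Z := by
    calc w * Z * w⁻¹ = x * (x⁻¹ * (w * Z * w⁻¹) * x) * x⁻¹ := by group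
      _ = Z := by rw [h8, hx.eq]; group
  show w * Z = Z * w
  nth_rw 2 [← h9]; group

lemma x_gz (m : ℕ) : Commute x (gz x w m) := by
  unfold gz; split_ifs with h
  · exact (Commute.refl x).pow_right 2
  · exact x_zeta H m (by omega)
lemma w_gz (m : ℕ) : Commute w (gz x w m) := by
  unfold gz; split_ifs with h
  · exact H.h0.symm
  · exact w_zeta H m (by omega)
lemma gz_sq (m : ℕ) : gz x w m * gz x w m = 1 := by
  unfold gz; split_ifs with h
  · rw [← pow_add]; exact H.h1
  · rw [← pow_add]; exact H.h2 m (by omega)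
lemma X_gz (i : ℤ) (m : ℕ) : Commute (gX x w i) (gz x w m) := by
  unfold gX
  exact (((w_gz H m).zpow_left i).mul_left (x_gz H m)).mul_left ((w_gz H m).zpow_left (-i))

lemma X_comm_lt (i : ℤ) (m : ℕ) :
    ∃ M, gX x w i * gX x w (i + m) = gX x w (i + m) * gX x w i * gz x w M ∨ m = 0 := by
  refine ⟨m, ?_⟩
  by_cases hm : m = 0
  · exact Or.inr hm
  left
  have h := aux2 (gX_sq H m)
  rw [← gb_eq] at h
  have hz : gz x w m = gb x w m ^ 2 := by simp [gz, hm]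
  rw [← hz] at h
  have h1 : gX x w (i + m) = w ^ i * gX x w m * w ^ (-i) := by unfold gX; group
  have h2 : gX x w i = w ^ i * x * w ^ (-i) := rfl
  have h3 : w ^ i * gz x w m * w ^ (-i) = gz x w m := by
    rw [((w_gz H m).zpow_left i).eq]; group
  calc gX x w i * gX x w (i + m) = w ^ i * (x * gX x w m) * w ^ (-i) := by rw [h1, h2]; group
    _ = gX x w (i + m) * gX x w i * (w ^ i * gz x w m * w ^ (-i)) := by rw [h, h1, h2]; group
    _ = _ := by rw [h3]

omit H in
variable (x w) in
def gC : Subgroup G := Subgroup.closure (Set.range (gz x w))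

lemma gC_comm (u : G) (hu : ∀ m, Commute u (gz x w m)) : ∀ c ∈ gC x w, c * u = u * c := by
  intro c hc
  have : gC x w ≤ Subgroup.centralizer {u} := by
    unfold gC
    rw [Subgroup.closure_le]
    rintro _ ⟨m, rfl⟩
    rw [SetLike.mem_coe, Subgroup.mem_centralizer_singleton_iff]
    exact (hu m).eq.symm
  have := this hc
  rw [Subgroup.mem_centralizer_singleton_iff] at this
  exact this

omit H in
lemma gz_mem (m : ℕ) : gz x w m ∈ gC x w := Subgroup.subset_closure ⟨m, rfl⟩

lemma X_comm (i j : ℤ) : ∃ c ∈ gC x w, gX x w i * gX x w j = gX x w j * gX x w i * c := by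
  rcases le_total i j with h | h
  · obtain ⟨M, h1 | h1⟩ := X_comm_lt H i (j - i).toNat
    · rw [show i + ((j - i).toNat : ℤ) = j by omega] at h1
      exact ⟨_, gz_mem M, h1⟩
    · have : i = j := by omega
      subst this; exact ⟨1, Subgroup.one_mem _, by simp⟩
  · obtain ⟨M, h1 | h1⟩ := X_comm_lt H j (i - j).toNat
    · rw [show j + ((i - j).toNat : ℤ) = i by omega] at h1
      refine ⟨_, Subgroup.inv_mem _ (gz_mem M), ?_⟩
      rw [h1]; group
    · have : i = j := by omega
      subst this; exact ⟨1, Subgroup.one_mem _, by simp⟩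

lemma C_form : ∀ c ∈ gC x w, ∃ M : List ℕ, M.Nodup ∧ c = (M.map (gz x w)).prod := by
  have hcc : ∀ i j, Commute (gz x w i) (gz x w j) := by
    intro i j
    have h1 := X_gz H 0 j
    unfold gz
    split_ifs with h h' h'
    · exact Commute.refl _
    · exact (x_zeta H j (by omega)).pow_left 2
    · exact ((x_zeta H i (by omega)).pow_left 2).symm
    · rw [gb_eq]
      have hz := X_gz H i j
      have hx := x_gz H j
      have hj : gz x w j = gb x w j ^ 2 := by simp [gz, h']
      rw [hj] at hz hx
      exact (hx.inv_left.mul_left hz).pow_left 2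
  intro c hc
  induction hc using Subgroup.closure_induction_left with
  | one => exact ⟨[], by simp, by simp⟩
  | mul_left u hu y hy ih =>
    obtain ⟨m, rfl⟩ := hu
    obtain ⟨M, h1, rfl⟩ := ih
    obtain ⟨M', h2, c, hc, h3⟩ := insert_prod (gz x w) ⊥
      (fun i j => ⟨1, Subgroup.one_mem _, by rw [(hcc i j).eq, mul_one]⟩)
      (by intro c hc i; rw [Subgroup.mem_bot] at hc; simp [hc])
      (by intro i; rw [Subgroup.mem_bot]; exact gz_sq H i) m h1
    rw [Subgroup.mem_bot] at hc
    exact ⟨M', h2, by rw [h3, hc, mul_one]⟩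
  | inv_mul_cancel u hu y hy ih =>
    obtain ⟨m, rfl⟩ := hu
    obtain ⟨M, h1, rfl⟩ := ih
    obtain ⟨M', h2, c, hc, h3⟩ := insert_prod (gz x w) ⊥
      (fun i j => ⟨1, Subgroup.one_mem _, by rw [(hcc i j).eq, mul_one]⟩)
      (by intro c hc i; rw [Subgroup.mem_bot] at hc; simp [hc])
      (by intro i; rw [Subgroup.mem_bot]; exact gz_sq H i) m h1
    rw [Subgroup.mem_bot] at hc
    refine ⟨M', h2, ?_⟩
    rw [inv_eq_of_mul_eq_one_right (gz_sq H m), h3, hc, mul_one]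

lemma w_prod (k : ℤ) (L : List ℤ) : w ^ k * (L.map (gX x w)).prod =
    ((L.map (· + k)).map (gX x w)).prod * w ^ k := by
  induction L with
  | nil => simp
  | cons a L ih =>
    simp only [List.map_cons, List.prod_cons]
    rw [← mul_assoc, w_X, mul_assoc, ih, mul_assoc]

lemma V_form0 : ∀ g ∈ Subgroup.closure {x, w}, ∃ L : List ℤ, L.Nodup ∧ ∃ c ∈ gC x w, ∃ k : ℤ,
    g = (L.map (gX x w)).prod * c * w ^ k := by
  have hX0 : gX x w 0 = x := by simp [gX]
  have hw : ∀ (k : ℤ) (y : G), (∃ L : List ℤ, L.Nodup ∧ ∃ c ∈ gC x w, ∃ k : ℤ,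
      y = (L.map (gX x w)).prod * c * w ^ k) → ∃ L : List ℤ, L.Nodup ∧ ∃ c ∈ gC x w, ∃ k' : ℤ,
      w ^ k * y = (L.map (gX x w)).prod * c * w ^ k' := by
    rintro k y ⟨L, h1, c, hc, k', rfl⟩
    refine ⟨L.map (· + k), h1.map (add_left_injective k), c, hc, k + k', ?_⟩
    have hcw := gC_comm H (w ^ k) (fun m => (w_gz H m).zpow_left k) c hc
    rw [← mul_assoc, ← mul_assoc, w_prod H, mul_assoc _ (w ^ k) c, ← hcw, _root_.zpow_add, mul_assoc,
      mul_assoc, mul_assoc]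
  have hx : ∀ (y : G), (∃ L : List ℤ, L.Nodup ∧ ∃ c ∈ gC x w, ∃ k : ℤ,
      y = (L.map (gX x w)).prod * c * w ^ k) → ∃ L : List ℤ, L.Nodup ∧ ∃ c ∈ gC x w, ∃ k' : ℤ,
      x * y = (L.map (gX x w)).prod * c * w ^ k' := by
    rintro y ⟨L, h1, c, hc, k', rfl⟩
    obtain ⟨L', h2, d, hd, h3⟩ := insert_prod (gX x w) (gC x w) (X_comm H)
      (fun c hc i => gC_comm H _ (X_gz H i) c hc)
      (fun i => by rw [gX_sq H]; have := gz_mem (x := x) (w := w) 0; simpa [gz] using this) 0 h1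
    rw [hX0] at h3
    refine ⟨L', h2, d * c, Subgroup.mul_mem _ hd hc, k', ?_⟩
    rw [← mul_assoc, ← mul_assoc, h3]; group
  intro g hg
  induction hg using Subgroup.closure_induction_left with
  | one => exact ⟨[], by simp, 1, Subgroup.one_mem _, 0, by simp⟩
  | mul_left u hu y hy ih =>
    rcases hu with rfl | hu
    · exact hx y ih
    · rw [Set.mem_singleton_iff] at hu
      subst hu
      simpa using hw 1 y ih
  | inv_mul_cancel u hu y hy ih =>
    rcases hu with rfl | hu
    · have : u⁻¹ = u * (u * u) := by
        apply inv_eq_of_mul_eq_one_right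
        rw [← H.h1]; simp only [pow_succ, pow_zero, one_mul, mul_assoc]
      rw [this, mul_assoc, mul_assoc]
      exact hx _ (hx _ (hx _ ih))
    · rw [Set.mem_singleton_iff] at hu
      subst hu
      simpa using hw (-1) y ih

lemma V_form : ∀ g ∈ Subgroup.closure {x, w}, ∃ L : List ℤ, L.Nodup ∧ ∃ M : List ℕ, M.Nodup ∧
    ∃ k : ℤ, g = (L.map (gX x w)).prod * (M.map (gz x w)).prod * w ^ k := by
  intro g hg
  obtain ⟨L, h1, c, hc, k, h2⟩ := V_form0 H g hg
  obtain ⟨M, h3, rfl⟩ := C_form H c hc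
  exact ⟨L, h1, M, h3, k, h2⟩
end abs


abbrev FG : Type := FreeGroup (Fin 2)

def Form (g : FG) (k : ℤ) (ρ c : R2) : Prop := ∀ p q r : R2,
  th g (p, q, r) = (T k * (p + (1 + T 1) * invert ρ * q + c * r), q + ρ * r, T k * r)

lemma TTi (k : ℤ) : (T k : R2) * T (-k) = 1 := by rw [← T_add]; simp

lemma tri {a b c a' b' c' : R2} (h1 : a = a') (h2 : b = b') (h3 : c = c') :
    ((a, b, c) : M3) = (a', b', c') := by rw [h1, h2, h3]

lemma Form.congr {g : FG} {k k' : ℤ} {ρ ρ' c c' : R2} (h : Form g k ρ c) (hk : k = k')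
    (hr : ρ = ρ') (hc : c = c') : Form g k' ρ' c' := by subst hk hr hc; exact h

lemma Form.mul {g g' : FG} {k k' : ℤ} {ρ ρ' c c' : R2} (h : Form g k ρ c) (h' : Form g' k' ρ' c') :
    Form (g * g') (k + k') (ρ' + T k' * ρ) (c' + T (-k') * (1 + T 1) * invert ρ * ρ' + c) := by
  intro p q r
  rw [th_mul, h', h]
  have h1 := TTi k'
  simp only [map_add, map_mul, invert_T, T_add]
  apply tri <;> grind

lemma Form.one : Form 1 0 0 0 := by
  intro p q r; simp

lemma Form.inv {g : FG} {k : ℤ} {ρ c : R2} (h : Form g k ρ c) :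
    Form g⁻¹ (-k) (T (-k) * ρ) (c + (1 + T 1) * invert ρ * ρ) := by
  intro p q r
  rw [map_inv]
  show (th g).symm _ = _
  rw [LinearEquiv.symm_apply_eq, h]
  have h1 := TTi k
  simp only [map_add, map_mul, invert_T, neg_neg]
  apply tri <;> grind

lemma Form_x : Form fx 0 1 (T 1) := by
  intro p q r; rw [x_act]; simp
lemma Form_xi : Form fx⁻¹ 0 1 1 := by
  intro p q r; rw [xi_act]; simp
lemma Form_tau : Form tau 1 0 0 := by
  intro p q r; rw [tau_act]; simp
lemma Form_w : Form ww 1 1 1 := by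
  rw [ww_eq]
  exact (Form_tau.mul Form_xi).congr (by simp) (by simp) (by simp)

lemma Form.unique {g : FG} {k k' : ℤ} {ρ ρ' c c' : R2} (h : Form g k ρ c) (h' : Form g k' ρ' c') :
    k = k' ∧ ρ = ρ' ∧ c = c' := by
  have e1 := (h 1 0 0).symm.trans (h' 1 0 0)
  have e2 := (h 0 0 1).symm.trans (h' 0 0 1)
  simp at e1 e2
  have hk := T_inj e1
  subst hk
  refine ⟨rfl, e2.2.1, ?_⟩
  exact mul_right_cancel₀ (T_ne k) (by simpa using e2.1)

lemma Form.eq {g g' : FG} {k : ℤ} {ρ c : R2} (h : Form g k ρ c) (h' : Form g' k ρ c) :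
    th g = th g' := by
  ext1 ⟨p, q, r⟩
  rw [h, h']

lemma Form.scal {g : FG} {k : ℤ} {ρ c a : R2} (h : Form g k ρ c) (h' : ∀ u, th g u = a • u) :
    k = 0 ∧ ρ = 0 ∧ c = 0 := by
  have e0 := (h 0 1 0).symm.trans (h' _)
  have e1 := (h 1 0 0).symm.trans (h' _)
  have e2 := (h 0 0 1).symm.trans (h' _)
  simp at e0 e1 e2
  obtain ⟨_, rfl⟩ := e0
  have hk : (T k : R2) = T 0 := by rw [e1, T_zero]
  have := T_ne k
  exact ⟨T_inj hk, e2.2.1, by simpa [this] using e2.1⟩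

lemma Form.exists_of_closure {g : FG} (hg : g ∈ Subgroup.closure {fx, ww}) :
    ∃ k ρ c, Form g k ρ c := by
  induction hg using Subgroup.closure_induction with
  | mem u hu =>
    rcases hu with rfl | rfl
    · exact ⟨_, _, _, Form_x⟩
    · exact ⟨_, _, _, Form_w⟩
  | one => exact ⟨_, _, _, Form.one⟩
  | mul a b _ _ ha hb =>
    obtain ⟨_, _, _, ha⟩ := ha
    obtain ⟨_, _, _, hb⟩ := hb
    exact ⟨_, _, _, ha.mul hb⟩
  | inv a _ ha =>
    obtain ⟨_, _, _, ha⟩ := ha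
    exact ⟨_, _, _, ha.inv⟩

lemma Form_wz (i : ℤ) : ∃ ρ c, Form (ww ^ i) i ρ c := by
  induction i using Int.induction_on with
  | zero => exact ⟨0, 0, by simpa using Form.one⟩
  | succ n ih =>
    obtain ⟨_, _, h⟩ := ih
    exact ⟨_, _, by rw [_root_.zpow_add_one]; exact h.mul Form_w⟩
  | pred n ih =>
    obtain ⟨_, _, h⟩ := ih
    exact ⟨_, _, by rw [_root_.zpow_sub_one, sub_eq_add_neg]; exact h.mul Form_w.inv⟩

lemma Form_X (i : ℤ) : ∃ c, Form (gX fx ww i) 0 (T (-i)) c := by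
  obtain ⟨ρ, c, h⟩ := Form_wz i
  have := (h.mul Form_x).mul h.inv
  rw [gX, _root_.zpow_neg]
  refine ⟨_, this.congr (by simp) ?_ rfl⟩
  simp only [T_zero]
  grind

lemma Form_b (i : ℤ) : ∃ c, Form (fx⁻¹ * gX fx ww i) 0 (1 + T (-i)) c := by
  obtain ⟨c, h⟩ := Form_X i
  refine ⟨_, (Form_xi.mul h).congr (by simp) ?_ rfl⟩
  simp [add_comm]

lemma Form.sq {g : FG} {ρ c : R2} (h : Form g 0 ρ c) : Form (g ^ 2) 0 0 ((1 + T 1) * (invert ρ * ρ)) := by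
  rw [pow_two]
  refine (h.mul h).congr (by simp) ?_ ?_
  · simp only [T_zero]; grind
  · simp only [T_zero, neg_zero]; grind

lemma Form.br {g g' : FG} {ρ c ρ' c' : R2} (h : Form g 0 ρ c) (h' : Form g' 0 ρ' c') :
    Form (br g g') 0 0 ((1 + T 1) * (invert ρ * ρ' + invert ρ' * ρ)) := by
  unfold _root_.br
  refine (((h.inv.mul h'.inv).mul h).mul h').congr (by simp) ?_ ?_
  · simp only [T_zero, neg_zero]; grind
  · simp only [T_zero, neg_zero, one_mul, map_add]; grind

lemma Form.mul0 {g g' : FG} {c c' : R2} (h : Form g 0 0 c) (h' : Form g' 0 0 c') :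
    Form (g * g') 0 0 (c + c') := by
  refine (h.mul h').congr (by simp) (by simp) ?_
  simp [add_comm]

lemma bwd_eq (i : ℕ) : bwd i = gb fx ww i := rfl

lemma Form_bwd (i : ℕ) : ∃ c, Form (gb fx ww i) 0 (1 + T (-(i : ℤ))) c := by
  rw [gb_eq]; exact Form_b i

def ScT : Subgroup FG where
  carrier := {g | ∃ m : ℤ, ∀ u, th g u = (T m : R2) • u}
  one_mem' := ⟨0, fun u => by simp⟩
  mul_mem' := by
    rintro a b ⟨m, hm⟩ ⟨n, hn⟩
    refine ⟨m + n, fun u => ?_⟩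
    rw [th_mul, hn, hm, smul_smul, T_add]
  inv_mem' := by
    rintro a ⟨m, hm⟩
    refine ⟨-m, fun u => ?_⟩
    rw [map_inv]
    show (th a).symm _ = _
    rw [LinearEquiv.symm_apply_eq, hm, smul_smul, TTi, one_smul]

lemma ScT_normal : ScT.Normal := by
  constructor
  rintro n ⟨m, hm⟩ g
  refine ⟨m, fun u => ?_⟩
  rw [th_mul, th_mul, hm, map_smul, ← th_mul, mul_inv_cancel, map_one]; rfl

lemma ScT_of_eq {a b : FG} (h : th a = th b) : a * b⁻¹ ∈ ScT := by
  refine ⟨0, fun u => ?_⟩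
  rw [map_mul, map_inv, h, mul_inv_cancel]; simp
lemma ScT_of_one {a : FG} (h : th a = 1) : a ∈ ScT := by
  refine ⟨0, fun u => ?_⟩
  rw [h]; simp

lemma Form.sq0 {g : FG} {c : R2} (h : Form g 0 0 c) : g ^ 2 ∈ ScT := by
  apply ScT_of_one
  rw [← map_one th]
  apply h.sq.eq
  simpa using Form.one

lemma rels_ScT : q42RelsB ⊆ (ScT : Set FG) := by
  have hx2 := Form_x.sq
  rintro r (((hr | ⟨i, hi, rfl⟩) | ⟨i, hi, rfl⟩) | ⟨i, j, hi, hj, rfl⟩)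
  · rcases hr with rfl | rfl | rfl
    · refine ⟨1, ?_⟩
      rintro ⟨p, q, r⟩
      rw [pow_succ, pow_two, th_mul, th_mul, y_act, y_act, y_act]
      simp only [xi_act, fi_act, Prod.smul_mk, smul_eq_mul]
      apply tri <;> grind
    · have h1 := hx2.mul Form_w
      have h2 := Form_w.mul hx2
      have h3 : th (fx ^ 2 * ww) = th (ww * fx ^ 2) := by
        refine (h1.congr (by simp) ?_ ?_).eq h2
        · simp
        · simp [T_zero]; grind
      have := ScT_of_eq h3
      have e : br (fx ^ 2) (fy * fx * fy) = (fx ^ 2)⁻¹ * ww⁻¹ * (fx ^ 2 * ww * (ww * fx ^ 2)⁻¹) * ((fx ^ 2)⁻¹ * ww⁻¹)⁻¹ := by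
        unfold br ww; group
      rw [e]
      exact ScT_normal.conj_mem _ this _
    · have := hx2.sq0
      rwa [← pow_mul] at this
  · obtain ⟨c, h⟩ := Form_bwd i
    have := h.sq.sq0
    rwa [← pow_mul] at this
  · obtain ⟨c, h⟩ := Form_bwd i
    rw [bwd_eq]
    refine ScT_of_eq (((Form_x.br h).congr rfl rfl ?_).eq h.sq)
    have := TTi i
    simp only [map_add, map_one, invert_T, neg_neg]; grind
  · obtain ⟨c, h⟩ := Form_bwd i
    obtain ⟨c', h'⟩ := Form_bwd j
    obtain ⟨c'', h''⟩ := Form_bwd (j - i)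
    rw [bwd_eq, bwd_eq, bwd_eq]
    refine ScT_of_eq ((h.br h').eq (((h.sq.mul0 h''.sq).mul0 h'.sq).congr rfl rfl ?_))
    have h1 := TTi i
    have h2 := TTi j
    have e : ((j - i : ℕ) : ℤ) = j + -i := by omega
    have e' : -((j - i : ℕ) : ℤ) = -j + i := by omega
    simp only [map_add, map_mul, map_one, invert_T, neg_neg, e', neg_add, T_add]
    clear h h' h'' e e' hx2
    grind

abbrev NN : Subgroup FG := Subgroup.normalClosure q42RelsB

lemma NN_ScT : NN ≤ ScT := by
  haveI := ScT_normal
  exact Subgroup.normalClosure_le_normal rels_ScT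

lemma list_sup (L : List ℤ) (hL : L.Nodup) (j : ℤ) :
    ((L.map fun i => (T (-i) : R2)).sum).coeff (-j) = if j ∈ L then 1 else 0 := by
  induction L with
  | nil => rfl
  | cons a L ih =>
    rw [List.nodup_cons] at hL
    rw [List.map_cons, List.sum_cons, coeff_add', ih hL.2, T_apply]
    by_cases h : a = j
    · subst h; simp [hL.1]
    · have h' : ¬ j = a := fun e => h e.symm
      simp [h, h']

def ee (m : ℕ) : R2 := if m = 0 then 1 else T m + T (-m)

lemma ee_coeff (m j : ℕ) : (ee m).coeff (j : ℤ) = if m = j then 1 else 0 := by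
  unfold ee
  split_ifs with h h' h'
  · subst h'; subst h
    rw [← T_zero, T_apply]; simp
  · subst h
    rw [← T_zero, T_apply, if_neg]; omega
  · subst h'
    rw [coeff_add', T_apply, T_apply, if_pos rfl, if_neg, add_zero]; omega
  · rw [coeff_add', T_apply, T_apply, if_neg, if_neg, add_zero] <;> omega

lemma list_ee (L : List ℕ) (hL : L.Nodup) (j : ℕ) :
    ((L.map ee).sum).coeff (j : ℤ) = if j ∈ L then 1 else 0 := by
  induction L with
  | nil => rfl
  | cons a L ih =>
    rw [List.nodup_cons] at hL
    rw [List.map_cons, List.sum_cons, coeff_add', ih hL.2, ee_coeff]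
    by_cases h : a = j
    · subst h; simp [hL.1]
    · have h' : ¬ j = a := fun e => h e.symm
      simp [h, h']

lemma Form_prodX (L : List ℤ) :
    ∃ c, Form ((L.map (gX fx ww)).prod) 0 ((L.map fun i => (T (-i) : R2)).sum) c := by
  induction L with
  | nil => exact ⟨0, Form.one⟩
  | cons a L ih =>
    obtain ⟨c, h⟩ := ih
    obtain ⟨d, h'⟩ := Form_X a
    simp only [List.map_cons, List.prod_cons, List.sum_cons]
    refine ⟨_, (h'.mul h).congr (by simp) ?_ rfl⟩
    simp [add_comm]

lemma Form_gz (m : ℕ) : Form (gz fx ww m) 0 0 ((1 + T 1) * ee m) := by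
  unfold gz ee
  split_ifs with h
  · simpa using Form_x.sq
  · obtain ⟨c, h⟩ := Form_bwd m
    refine h.sq.congr rfl rfl ?_
    have := TTi m
    simp only [map_add, map_one, invert_T, neg_neg]; grind

lemma Form_prodz (L : List ℕ) :
    Form ((L.map (gz fx ww)).prod) 0 0 ((1 + T 1) * (L.map ee).sum) := by
  induction L with
  | nil => simpa using Form.one
  | cons a L ih =>
    simp only [List.map_cons, List.prod_cons, List.sum_cons, mul_add]
    exact (Form_gz a).mul0 ih

lemma rel_mem {r : FG} (h : r ∈ q42RelsB) : (r : FG ⧸ NN) = 1 :=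
  (QuotientGroup.eq_one_iff r).2 (Subgroup.subset_normalClosure h)

lemma gb_map {G H : Type*} [Group G] [Group H] (φ : G →* H) (x w : G) (i : ℕ) :
    φ (gb x w i) = gb (φ x) (φ w) i := by simp [gb, br]
lemma gX_map {G H : Type*} [Group G] [Group H] (φ : G →* H) (x w : G) (i : ℤ) :
    φ (gX x w i) = gX (φ x) (φ w) i := by simp [gX]
lemma gz_map {G H : Type*} [Group G] [Group H] (φ : G →* H) (x w : G) (i : ℕ) :
    φ (gz x w i) = gz (φ x) (φ w) i := by
  unfold gz; split_ifs <;> simp [gb_map]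
lemma br_map {G H : Type*} [Group G] [Group H] (φ : G →* H) (x w : G) :
    φ (br x w) = br (φ x) (φ w) := by simp [br]

lemma GRel_quot : GRel (QuotientGroup.mk' NN fx) (QuotientGroup.mk' NN ww) := by
  set φ := QuotientGroup.mk' NN with hφ
  have hr : ∀ r ∈ q42RelsB, φ r = 1 := fun r h => rel_mem h
  refine ⟨?_, ?_, ?_, ?_⟩
  · have h := hr (br (fx ^ 2) ww) (Or.inl (Or.inl (Or.inl (Or.inr (Or.inl rfl)))))
    rw [br_map, br, map_pow, mul_assoc, ← _root_.mul_inv_rev, inv_mul_eq_one] at h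
    exact h.symm
  · have h := hr (fx ^ 4) (Or.inl (Or.inl (Or.inl (Or.inr (Or.inr rfl)))))
    rwa [map_pow] at h
  · intro i hi
    have h := hr (bwd i ^ 4) (Or.inl (Or.inl (Or.inr ⟨i, hi, rfl⟩)))
    rwa [map_pow, bwd_eq, gb_map] at h
  · intro i j hi hj
    have h := hr _ (Or.inr ⟨i, j, hi, hj, rfl⟩)
    rw [map_mul, map_inv, mul_inv_eq_one] at h
    simpa only [bwd_eq, br_map, gb_map, map_mul, map_pow] using h

def VV : Subgroup FG := Subgroup.closure {fx, ww} ⊔ NN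

lemma VV_dec {v : FG} (hv : v ∈ VV) : ∃ a ∈ Subgroup.closure {fx, ww}, ∃ n ∈ NN, v = a * n := by
  unfold VV at hv
  rw [← SetLike.mem_coe, Subgroup.mul_normal] at hv
  obtain ⟨a, ha, n, hn, rfl⟩ := hv
  exact ⟨a, ha, n, hn, rfl⟩

lemma lemmaV {v : FG} (hv : v ∈ VV) {a : R2} (h : ∀ u, th v u = a • u) : v ∈ NN := by
  obtain ⟨v0, h0, n, hn, rfl⟩ := VV_dec hv
  have hmem : QuotientGroup.mk' NN v0 ∈
      Subgroup.closure {QuotientGroup.mk' NN fx, QuotientGroup.mk' NN ww} := by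
    have := Subgroup.mem_map_of_mem (QuotientGroup.mk' NN) h0
    rw [MonoidHom.map_closure] at this
    simpa [Set.image_pair] using this
  obtain ⟨L, hL, M, hM, k, hk⟩ := V_form GRel_quot _ hmem
  set u0 := (L.map (gX fx ww)).prod * (M.map (gz fx ww)).prod * ww ^ k with hu0
  have hu : QuotientGroup.mk' NN v0 = QuotientGroup.mk' NN u0 := by
    rw [hk, hu0, map_mul, map_mul, map_zpow, map_list_prod, map_list_prod, List.map_map,
      List.map_map]
    have e1 : (gX ((QuotientGroup.mk' NN) fx) ((QuotientGroup.mk' NN) ww)) =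
      (QuotientGroup.mk' NN) ∘ gX fx ww := by
      funext i; exact (gX_map _ _ _ _).symm
    have e2 : (gz ((QuotientGroup.mk' NN) fx) ((QuotientGroup.mk' NN) ww)) =
      (QuotientGroup.mk' NN) ∘ gz fx ww := by
      funext i; exact (gz_map _ _ _ _).symm
    rw [e1, e2]
  have hn' : u0⁻¹ * v0 ∈ NN := by
    rw [QuotientGroup.mk'_apply, QuotientGroup.mk'_apply] at hu
    exact QuotientGroup.eq.1 hu.symm
  have hn2 : u0⁻¹ * v0 * n ∈ NN := NN.mul_mem hn' hn
  obtain ⟨m, hm⟩ := NN_ScT (NN.inv_mem hn2)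
  have hsc : ∀ u, th u0 u = (T m * a) • u := by
    intro u
    have e : u0 = (v0 * n) * (u0⁻¹ * v0 * n)⁻¹ := by group
    rw [e, th_mul, hm, map_smul, h, smul_smul]
  obtain ⟨c1, f1⟩ := Form_prodX L
  obtain ⟨ρ3, c3, f3⟩ := Form_wz k
  have f := ((f1.mul (Form_prodz M)).mul f3)
  have hk0 := (f.scal hsc).1
  simp only [zero_add] at hk0
  subst hk0
  have f4 := (f3.unique (by rw [zpow_zero]; exact Form.one))
  obtain ⟨_, rfl, rfl⟩ := f4
  have f5 := (f.scal hsc).2.1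
  have f6 := (f.scal hsc).2.2
  simp only [T_zero, zero_add, one_mul] at f5
  have hL0 : L = [] := by
    rw [List.eq_nil_iff_forall_not_mem]
    intro j hj
    have := list_sup L hL j
    rw [f5, if_pos hj] at this
    exact absurd this (by simp)
  subst hL0
  have f7 := f1.unique Form.one
  obtain ⟨_, _, rfl⟩ := f7
  simp only [List.map_nil, List.sum_nil, map_zero, mul_zero, zero_mul, add_zero, zero_add] at f6
  have f8 : (M.map ee).sum = 0 := by
    rcases mul_eq_zero.1 f6 with h | h
    · exact absurd h one_t_ne
    · exact h
  have hM0 : M = [] := by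
    rw [List.eq_nil_iff_forall_not_mem]
    intro j hj
    have := list_ee M hM j
    rw [f8, if_pos hj] at this
    exact absurd this (by simp)
  subst hM0
  have : u0 = 1 := by rw [hu0]; simp
  rw [this] at hn2
  simpa using hn2


def vc (g : FG) : M3 := th g⁻¹ (1, 0, 0)

lemma vc_mul (g a : FG) : vc (g * a) = th a⁻¹ (vc g) := by
  unfold vc; rw [_root_.mul_inv_rev, th_mul]

lemma vc_ne (g : FG) : vc g ≠ 0 := by
  unfold vc
  rw [Ne, LinearEquiv.map_eq_zero_iff]
  intro h
  have := congrArg Prod.fst h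
  simp at this

def Iso (u : M3) : Prop := u.1 * invert u.2.2 + T 1 * invert u.1 * u.2.2
  = (1 + T 1) * (u.2.1 * invert u.2.1)

lemma inv_inv' (p : R2) : invert (invert p) = p := involutive_invert p

lemma Iso_x {u : M3} (h : Iso u) : Iso (th fx u) := by
  obtain ⟨p, q, r⟩ := u
  rw [x_act]
  have := hts
  unfold Iso at *
  simp only [map_add, map_mul, map_one, invert_T] at *
  grind
lemma Iso_xi {u : M3} (h : Iso u) : Iso (th fx⁻¹ u) := by
  obtain ⟨p, q, r⟩ := u
  rw [xi_act]
  have := hts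
  unfold Iso at *
  simp only [map_add, map_mul, map_one, invert_T] at *
  grind
lemma Iso_f {u : M3} (h : Iso u) : Iso (th ff u) := by
  obtain ⟨p, q, r⟩ := u
  rw [f_act]
  have := hts
  unfold Iso at *
  simp only [map_add, map_mul, map_one, invert_T, neg_neg] at *
  grind
lemma Iso_fi {u : M3} (h : Iso u) : Iso (th ff⁻¹ u) := by
  obtain ⟨p, q, r⟩ := u
  rw [fi_act]
  have := hts
  unfold Iso at *
  simp only [map_add, map_mul, map_one, invert_T, neg_neg] at *
  grind

lemma fy_eq : fy = ff⁻¹ * fx⁻¹ := by simp [ff]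
lemma fyi_eq : fy⁻¹ = fx * ff := by simp [ff]

lemma Iso_th (g : FG) : ∀ u, Iso u → Iso (th g u) := by
  induction g using FreeGroup.induction_on with
  | C1 => intro u h; simpa using h
  | of i =>
    intro u h
    fin_cases i
    · exact Iso_x h
    · show Iso (th fy u)
      rw [fy_eq, th_mul]
      exact Iso_fi (Iso_xi h)
  | inv_of i _ =>
    intro u h
    fin_cases i
    · exact Iso_xi h
    · show Iso (th fy⁻¹ u)
      rw [fyi_eq, th_mul]
      exact Iso_x (Iso_f h)
  | mul a b ha hb =>
    intro u h
    rw [th_mul]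
    exact ha _ (hb _ h)

lemma Iso_vc (g : FG) : Iso (vc g) := by
  apply Iso_th
  simp [Iso]

def EdgeP (N : ℕ) (p r : R2) : Prop := ∃ l : ℤ,
  (∀ i, p.coeff i ≠ 0 → l ≤ 2 * i ∧ 2 * i < l + N) ∧
  (∀ i, r.coeff i ≠ 0 → l ≤ 2 * i + 1 ∧ 2 * i + 1 < l + N)

def lowP (N : ℕ) (r : R2) : Prop := ∃ l : ℤ,
  ∀ i, r.coeff i ≠ 0 → l ≤ 2 * i + 1 ∧ 2 * i + 1 < l + N

lemma EdgeP.scale {N : ℕ} {p r : R2} (h : EdgeP N p r) (j : ℤ) : EdgeP N (T j * p) (T j * r) := by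
  obtain ⟨l, h1, h2⟩ := h
  refine ⟨l + 2 * j, fun i hi => ?_, fun i hi => ?_⟩ <;> rw [coeff_T_mul] at hi
  · have := h1 _ hi; omega
  · have := h2 _ hi; omega

lemma lowP.scale {N : ℕ} {r : R2} (h : lowP N r) (j : ℤ) : lowP N (T j * r) := by
  obtain ⟨l, h2⟩ := h
  refine ⟨l + 2 * j, fun i hi => ?_⟩
  rw [coeff_T_mul] at hi
  have := h2 _ hi; omega

lemma Tcancel (j : ℤ) (p : R2) : T (-j) * (T j * p) = p := by
  rw [TT]; simp

lemma lowP.unscale {N : ℕ} {r : R2} {j : ℤ} (h : lowP N (T j * r)) : lowP N r := by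
  have := h.scale (-j)
  rwa [Tcancel] at this

lemma EdgeP.unscale {N : ℕ} {p r : R2} {j : ℤ} (h : EdgeP N (T j * p) (T j * r)) : EdgeP N p r := by
  have := h.scale (-j)
  rwa [Tcancel, Tcancel] at this

lemma EdgeP.fi {N : ℕ} {p r : R2} (h : EdgeP N p r) : EdgeP N (T 1 * r) p := by
  obtain ⟨l, h1, h2⟩ := h
  refine ⟨l + 1, fun i hi => ?_, fun i hi => ?_⟩
  · rw [coeff_T_mul] at hi
    have := h2 _ hi; omega
  · have := h1 _ hi; omega

lemma EdgeP.low {N : ℕ} {p r : R2} (h : EdgeP N p r) : lowP N r := by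
  obtain ⟨l, h1, h2⟩ := h
  exact ⟨l, h2⟩

lemma EdgeP.mono {N N' : ℕ} (hN : N ≤ N') {p r : R2} (h : EdgeP N p r) : EdgeP N' p r := by
  obtain ⟨l, h1, h2⟩ := h
  refine ⟨l, fun i hi => ?_, fun i hi => ?_⟩
  · have := h1 _ hi; omega
  · have := h2 _ hi; omega

lemma EdgeP.exists (p r : R2) : ∃ N, EdgeP N p r := by
  obtain ⟨a, b, h⟩ := exists_sup p
  obtain ⟨c, d, h'⟩ := exists_sup r
  refine ⟨(2 * |a| + 2 * |b| + 2 * |c| + 2 * |d| + 2).toNat, -2 * |a| - 2 * |c|, fun i hi => ?_, fun i hi => ?_⟩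
  · have := h i hi
    have := neg_abs_le a
    have := le_abs_self b
    have := abs_nonneg c
    have := abs_nonneg d
    have := abs_nonneg a
    have := abs_nonneg b
    omega
  · have := h' i hi
    have := neg_abs_le c
    have := le_abs_self d
    have := abs_nonneg c
    have := abs_nonneg d
    have := abs_nonneg a
    have := abs_nonneg b
    omega

def Edge (N : ℕ) (g : FG) : Prop := EdgeP N (vc g).1 (vc g).2.2
def low (N : ℕ) (g : FG) : Prop := lowP N (vc g).2.2

lemma vc_f (g : FG) : vc (g * ff) = (T 1 * (vc g).2.2, (vc g).2.1, (vc g).1) := by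
  rw [vc_mul, ← fi_act]

lemma Edge.f {N : ℕ} {g : FG} (h : Edge N g) : Edge N (g * ff) := by
  unfold Edge; rw [vc_f]; exact EdgeP.fi h

lemma NN_VV : NN ≤ VV := le_sup_right
lemma x_VV : fx ∈ VV := Subgroup.mem_sup_left (Subgroup.subset_closure (by simp))
lemma w_VV : ww ∈ VV := Subgroup.mem_sup_left (Subgroup.subset_closure (by simp))
lemma tau_VV : tau ∈ VV := VV.mul_mem w_VV x_VV
lemma tau_cl : tau ∈ Subgroup.closure {fx, ww} :=
  Subgroup.mul_mem _ (Subgroup.subset_closure (by simp)) (Subgroup.subset_closure (by simp))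
lemma y3_NN : fy ^ 3 ∈ NN := Subgroup.subset_normalClosure (Or.inl (Or.inl (Or.inl (Or.inl rfl))))

lemma Form_tauz (i : ℤ) : Form (tau ^ i) i 0 0 := by
  induction i using Int.induction_on with
  | zero => simpa using Form.one
  | succ n ih =>
    rw [_root_.zpow_add_one]
    exact (ih.mul Form_tau).congr rfl (by simp) (by simp)
  | pred n ih =>
    rw [_root_.zpow_sub_one, sub_eq_add_neg]
    exact (ih.mul Form_tau.inv).congr rfl (by simp) (by simp)

lemma tauz_f (k : ℤ) : tau ^ k * ff = ff * tau ^ k := (Commute.zpow_left tau_comm k).eq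

lemma vc_tau (g : FG) (k : ℤ) : vc (g * tau ^ k) =
    (T (-k) * (vc g).1, (vc g).2.1, T (-k) * (vc g).2.2) := by
  rw [vc_mul, ← _root_.zpow_neg]
  have := Form_tauz (-k) (vc g).1 (vc g).2.1 (vc g).2.2
  simpa using this

/-- general shape of the action of `VV` -/
lemma VV_shape {v : FG} (hv : v ∈ VV) : ∃ (v' : FG) (k m : ℤ) (ρ c : R2),
    v' ∈ VV ∧ Form v'⁻¹ 0 ρ c ∧ (∃ n ∈ NN, v = v' * tau ^ (-k) * n) ∧
    ∀ g, vc (g * v) = (T (m + k) * (vc (g * v')).1, T m * (vc (g * v')).2.1,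
      T (m + k) * (vc (g * v')).2.2) := by
  obtain ⟨a, ha, n, hn, rfl⟩ := VV_dec hv
  obtain ⟨k, ρ, c, f⟩ := Form.exists_of_closure (Subgroup.inv_mem _ ha)
  obtain ⟨m, hm⟩ := NN_ScT (NN.inv_mem hn)
  have hf : Form (a * tau ^ k)⁻¹ 0 ρ c := by
    rw [_root_.mul_inv_rev, ← _root_.zpow_neg]
    exact ((Form_tauz (-k)).mul f).congr (by simp) (by simp) (by simp)
  refine ⟨a * tau ^ k, k, m, ρ, c, ?_, hf, ⟨n, hn, by simp⟩, fun g => ?_⟩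
  · exact VV.mul_mem (Subgroup.mem_sup_left ha) (VV.zpow_mem tau_VV k)
  · rw [vc_mul, vc_mul, _root_.mul_inv_rev, th_mul, hm, hf, f] 
    simp only [Prod.smul_mk, smul_eq_mul, T_add, T_zero]
    apply tri <;> ring


def Stp (N : ℕ) (a b : FG) : Prop := a⁻¹ * b ∈ VV ∨ (b = a * ff ∧ Edge N a)
def Conn (N : ℕ) : FG → FG → Prop := Relation.ReflTransGen (Stp N)

lemma Conn.trans {N : ℕ} {a b c : FG} (h : Conn N a b) (h' : Conn N b c) : Conn N a c :=
  Relation.ReflTransGen.trans h h'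
lemma conn_V {N : ℕ} {a b : FG} (h : a⁻¹ * b ∈ VV) : Conn N a b :=
  Relation.ReflTransGen.single (Or.inl h)
lemma conn_mul {N : ℕ} {a v : FG} (h : v ∈ VV) : Conn N a (a * v) :=
  conn_V (by simpa using h)
lemma conn_f {N : ℕ} {a : FG} (h : Edge N a) : Conn N a (a * ff) :=
  Relation.ReflTransGen.single (Or.inr ⟨rfl, h⟩)
lemma ff_sq (a : FG) : a * ff * ff = a * tau⁻¹ := by
  rw [tau_eq, _root_.mul_inv_rev, inv_inv, mul_assoc]
lemma conn_ff {N : ℕ} (a : FG) : Conn N (a * ff * ff) a := by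
  rw [ff_sq]
  exact conn_V (by simpa using tau_VV)
lemma conn_ff' {N : ℕ} (a : FG) : Conn N a (a * ff * ff) := by
  rw [ff_sq]
  exact conn_mul (VV.inv_mem tau_VV)
lemma conn_fsymm {N : ℕ} {a : FG} (h : Edge N a) : Conn N (a * ff) a :=
  (conn_f h.f).trans (conn_ff a)
lemma Conn.symm {N : ℕ} {a b : FG} (h : Conn N a b) : Conn N b a := by
  induction h with
  | refl => exact Relation.ReflTransGen.refl
  | tail _ hs ih =>
    refine Conn.trans ?_ ih
    rcases hs with hs | ⟨rfl, hs⟩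
    · apply conn_V
      have := VV.inv_mem hs
      simpa using this
    · exact conn_fsymm hs
lemma Conn.mono {N N' : ℕ} (hN : N ≤ N') {a b : FG} (h : Conn N a b) : Conn N' a b := by
  induction h with
  | refl => exact Relation.ReflTransGen.refl
  | tail _ hs ih =>
    refine ih.tail ?_
    rcases hs with h | ⟨h1, h2⟩
    · exact Or.inl h
    · exact Or.inr ⟨h1, EdgeP.mono hN h2⟩

lemma key_VV : fy ^ 2 * ff ∈ VV := by
  have : fy ^ 2 * ff = fy ^ 3 * ww⁻¹ := by simp only [ff, ww]; group
  rw [this]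
  exact VV.mul_mem (NN_VV y3_NN) (VV.inv_mem w_VV)

lemma A0 {N : ℕ} {g : FG} {p q r : R2} (hg : vc g = (p, q, r))
    (h1 : EdgeP N (p + (1 + T 1) * q + r) r) (h2 : EdgeP N p (p + (1 + T 1) * q + r)) :
    Conn N g (g * ff) := by
  have e1 : vc (g * fx) = (p + (1 + T 1) * q + r, q + r, r) := by rw [vc_mul, hg, xi_act]
  have e2 : vc (g * fx * ff * fx) = (p, q + r + (p + (1 + T 1) * q + r), p + (1 + T 1) * q + r) := by
    rw [vc_mul, vc_f, e1, xi_act]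
    apply tri <;> grind
  have s1 : Conn N g (g * fx) := conn_mul x_VV
  have s2 : Conn N (g * fx) (g * fx * ff) := conn_f (by unfold Edge; rw [e1]; exact h1)
  have s3 : Conn N (g * fx * ff) (g * fx * ff * fx) := conn_mul x_VV
  have s4 : Conn N (g * fx * ff * fx) (g * fx * ff * fx * ff) :=
    conn_f (by unfold Edge; rw [e2]; exact h2)
  have s5 : Conn N (g * fx * ff * fx * ff) (g * ff) := by
    apply conn_V
    have : (g * fx * ff * fx * ff)⁻¹ * (g * ff) = fy ^ 2 * ff := by simp only [ff]; group
    rw [this]; exact key_VV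
  exact (((s1.trans s2).trans s3).trans s4).trans s5

lemma A1 {N : ℕ} {g : FG} {p q r : R2} (hg : vc g = (p, q, r)) (k : ℤ)
    (h1 : EdgeP N (p + T k * ((1 + T 1) * q) + r) r)
    (h2 : EdgeP N p (p + T k * ((1 + T 1) * q) + r)) :
    Conn N g (g * ff) := by
  have e : vc (g * tau ^ k) = (T (-k) * p, q, T (-k) * r) := by rw [vc_tau, hg]
  have e' : T (-k) * (p + T k * ((1 + T 1) * q) + r) = T (-k) * p + (1 + T 1) * q + T (-k) * r := by
    rw [mul_add, mul_add, Tcancel]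
  have := A0 (N := N) e (by rw [← e']; exact h1.scale _) (by rw [← e']; exact h2.scale _)
  have s1 : Conn N g (g * tau ^ k) := conn_mul (VV.zpow_mem tau_VV k)
  have s2 : Conn N (g * tau ^ k * ff) (g * ff) := by
    rw [mul_assoc, tauz_f, ← mul_assoc]
    exact (conn_mul (VV.zpow_mem tau_VV k)).symm
  exact (s1.trans this).trans s2

lemma A_poly {p q r : R2} (hi : Iso (p, q, r)) {N : ℕ} {a M : ℤ} (hN : (N : ℤ) = 2 * M - 1)
    (hp : Sup p (a + 1) (a + M)) (hpt : p.coeff (a + M) = 1)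
    (hr : Sup r a (a + M - 1)) (hra : r.coeff a = 1) :
    ∃ k, EdgeP N (p + T k * ((1 + T 1) * q) + r) r ∧
      EdgeP N p (p + T k * ((1 + T 1) * q) + r) := by
  unfold Iso at hi
  simp only at hi
  have s1 := hp.mul hr.inv
  have t1 := coeff_mul_top hp hr.inv
  rw [invert_apply, neg_neg, hpt, hra, mul_one] at t1
  have s2 := (hp.inv.mul hr).T_mul 1
  rw [← mul_assoc] at s2
  have htop : ((1 + T 1) * (q * invert q)).coeff M = 1 := by
    rw [← hi, coeff_add', s2.zero_of (by omega), add_zero, ← t1]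
    congr 1; omega
  have hs : Sup ((1 + T 1) * (q * invert q)) (1 - M) M := by
    rw [← hi]
    exact (s1.mono (by omega) (by omega)).add (s2.mono (by omega) (by omega))
  have hq : q ≠ 0 := by
    rintro rfl
    rw [zero_mul, mul_zero] at htop
    exact absurd htop (show ¬ ((0 : ZMod 2) = 1) by decide)
  obtain ⟨B, C, hBC, hq, hB, hC⟩ := exists_ends hq
  have w1 := width_le hq hB hC hs
  have w2 : M ≤ C - B + 1 := by
    have := ((hq.mul hq.inv).t1 M (by rw [htop]; decide)).2
    omega
  have hC' : C = B + M - 1 := by omega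
  subst hC'
  set u := T (a - B) * ((1 + T 1) * q) with hu
  have us : Sup u a (a + M) := hq.t1.T_mul' _ (by omega) (by omega)
  have ua : u.coeff a = 1 := by
    rw [hu, coeff_T_mul, t1_coeff, hq.zero_of (i := a - (a - B) - 1) (by omega),
      show a - (a - B) = B by ring, hB, add_zero]
  have ut : u.coeff (a + M) = 1 := by
    rw [hu, coeff_T_mul, t1_coeff, hq.zero_of (i := a + M - (a - B)) (by omega),
      show a + M - (a - B) - 1 = B + M - 1 by ring, hC, zero_add]
  have hs'' : Sup (p + u + r) (a + 1) (a + M - 1) := by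
    intro i h
    have h1 := (((hp.mono (by omega) le_rfl).add us).add (hr.mono le_rfl (by omega))) i h
    constructor
    · by_contra hc
      have : i = a := by omega
      subst this
      rw [coeff_add', coeff_add', ua, hra, hp.zero_of (by omega)] at h
      exact h (by decide)
    · by_contra hc
      have : i = a + M := by omega
      subst this
      rw [coeff_add', coeff_add', ut, hpt, hr.zero_of (by omega)] at h
      exact h (by decide)
  refine ⟨a - B, ⟨2 * a + 1, fun i h => ?_, fun i h => ?_⟩, ⟨2 * a + 2, fun i h => ?_, fun i h => ?_⟩⟩
  · have := hs'' i h; omega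
  · have := hr i h; omega
  · have := hp i h; omega
  · have := hs'' i h; omega

lemma A_good {N : ℕ} {g : FG} {a M : ℤ} (hN : (N : ℤ) = 2 * M - 1)
    (hp : Sup (vc g).1 (a + 1) (a + M)) (hpt : (vc g).1.coeff (a + M) = 1)
    (hr : Sup (vc g).2.2 a (a + M - 1)) (hra : (vc g).2.2.coeff a = 1) :
    Conn N g (g * ff) := by
  obtain ⟨k, h1, h2⟩ := A_poly (Iso_vc g) hN hp hpt hr hra
  exact A1 rfl k h1 h2

lemma claimA {N : ℕ} {g : FG} (he : Edge (N + 1) g) (h1 : low N g) (h2 : low N (g * ff)) :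
    Conn N g (g * ff) := by
  by_cases hE : Edge N g
  · exact conn_f hE
  unfold low at h1 h2
  rw [vc_f] at h2
  simp only at h2
  obtain ⟨l, hp, hr⟩ := he
  push_cast at hp hr
  have hbot : (∃ i, (vc g).1.coeff i ≠ 0 ∧ 2 * i = l) ∨ (∃ i, (vc g).2.2.coeff i ≠ 0 ∧ 2 * i + 1 = l) := by
    by_contra! hc
    apply hE
    refine ⟨l + 1, fun i hi => ?_, fun i hi => ?_⟩
    · have := hp i hi; have := hc.1 i hi; omega
    · have := hr i hi; have := hc.2 i hi; omega
  have htop : (∃ i, (vc g).1.coeff i ≠ 0 ∧ 2 * i = l + N) ∨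
      (∃ i, (vc g).2.2.coeff i ≠ 0 ∧ 2 * i + 1 = l + N) := by
    by_contra! hc
    apply hE
    refine ⟨l, fun i hi => ?_, fun i hi => ?_⟩
    · have := hp i hi; have := hc.1 i hi; omega
    · have := hr i hi; have := hc.2 i hi; omega
  obtain ⟨l1, h1⟩ := h1
  obtain ⟨l2, h2⟩ := h2
  rcases hbot with ⟨i, hi, hil⟩ | ⟨i, hi, hil⟩ <;> rcases htop with ⟨j, hj, hjl⟩ | ⟨j, hj, hjl⟩
  · have := h2 i hi; have := h2 j hj; omega
  · have := A_good (N := N) (g := g * ff) (a := i) (M := j + 1 - i) (by omega) (by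
      rw [vc_f]; intro s hs
      simp only at hs
      rw [coeff_T_mul] at hs
      have := hr _ hs; omega) (by
      rw [vc_f]
      simp only
      rw [coeff_T_mul, show i + (j + 1 - i) - 1 = j by ring]
      exact zm2 hj) (by
      rw [vc_f]; intro s hs
      simp only at hs
      have := hp _ hs; omega) (by rw [vc_f]; exact zm2 hi)
    exact (this.trans (conn_ff g)).symm
  · exact A_good (N := N) (g := g) (a := i) (M := j - i) (by omega) (by
      intro s hs
      have := hp _ hs; omega) (by
      rw [show i + (j - i) = j by ring]
      exact zm2 hj) (by
      intro s hs
      have := hr _ hs; omega) (zm2 hi)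
  · have := h1 i hi; have := h1 j hj; omega


instance NN_normal' : NN.Normal := Subgroup.normalClosure_normal

lemma B_width {p q r : R2} (hi : Iso (p, q, r)) {a M : ℤ} (hp : Sup p (a + 1) (a + M))
    (hr : Sup r a (a + M)) {i j : ℤ} (h1 : q.coeff i ≠ 0) (h2 : q.coeff j ≠ 0) : j - i ≤ M - 1 := by
  unfold Iso at hi
  simp only at hi
  have s1 := hp.mul hr.inv
  have s2 := (hp.inv.mul hr).T_mul 1
  rw [← mul_assoc] at s2
  have hs : Sup ((1 + T 1) * (q * invert q)) (1 - M) M := by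
    rw [← hi]
    exact (s1.mono (by omega) (by omega)).add (s2.mono (by omega) (by omega))
  have hq : q ≠ 0 := by
    rintro rfl
    exact h1 rfl
  obtain ⟨B, C, hBC, hq, hB, hC⟩ := exists_ends hq
  have w1 := width_le hq hB hC hs
  have := hq i h1
  have := hq j h2
  omega

/-- the data of a bad pair -/
def Bad (g : FG) (a M : ℤ) : Prop :=
  Sup (vc g).1 (a + 1) (a + M) ∧ Sup (vc g).2.2 a (a + M) ∧ (vc g).2.2.coeff a = 1 ∧
    (vc g).2.2.coeff (a + M) = 1

lemma Form.vc {g v : FG} {ρ c : R2} (h : Form v⁻¹ 0 ρ c) : vc (g * v) =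
    ((vc g).1 + (1 + T 1) * invert ρ * (vc g).2.1 + c * (vc g).2.2,
      (vc g).2.1 + ρ * (vc g).2.2, (vc g).2.2) := by
  rw [vc_mul]
  have := h (_root_.vc g).1 (_root_.vc g).2.1 (_root_.vc g).2.2
  simpa using this

lemma or_ne {x y : ZMod 2} (h : y = 1) : x ≠ 0 ∨ x + y ≠ 0 := by
  subst h; revert x; decide

def ss (K : ℤ) : FG := tau ^ (-K) * fx⁻¹ * tau ^ K
lemma ss_inv (K : ℤ) : (ss K)⁻¹ = tau ^ (-K) * fx * tau ^ K := by unfold ss; group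
lemma ss_VV (K : ℤ) : ss K ∈ VV :=
  VV.mul_mem (VV.mul_mem (VV.zpow_mem tau_VV _) (VV.inv_mem x_VV)) (VV.zpow_mem tau_VV _)
lemma Form_ssi (K : ℤ) : Form (ss K)⁻¹ 0 (T K) (T 1) := by
  rw [ss_inv]
  exact (((Form_tauz (-K)).mul Form_x).mul (Form_tauz K)).congr (by simp) (by simp) (by simp)
lemma Form_ss (K : ℤ) : Form (ss K) 0 (T K) 1 := by
  unfold ss
  exact (((Form_tauz (-K)).mul Form_xi).mul (Form_tauz K)).congr (by simp) (by simp) (by simp)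

lemma B_step {N : ℕ} {g : FG} {K : ℤ}
    (h : EdgeP N ((vc g).1 + T (-K) * ((1 + T 1) * (vc g).2.1) + T 1 * (vc g).2.2) (vc g).1) :
    Conn N (g * ff) (g * ss K * ff) := by
  set b := g * tau ^ (-K) with hb
  have e : vc b = (T K * (vc g).1, (vc g).2.1, T K * (vc g).2.2) := by rw [hb, vc_tau, neg_neg]
  have s1 : Conn N (g * ff) (b * ff) := by
    rw [hb, mul_assoc, tauz_f, ← mul_assoc]
    exact conn_mul (VV.zpow_mem tau_VV _)
  have s2 : Conn N (b * ff) (b * ff * fx) := conn_mul x_VV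
  have s3 : Conn N (b * ff * fx) (b * ff * fx * ff) := by
    apply conn_f
    unfold Edge
    rw [vc_mul, vc_f, e, xi_act]
    have := h.scale K
    convert this using 1
    have := TTi K
    grind
  have s4 : Conn N (b * ff * fx * ff) (b * fx⁻¹ * ff) := by
    apply conn_V
    have : (b * ff * fx * ff)⁻¹ * (b * fx⁻¹ * ff) = fy ^ 2 * ff := by simp only [ff]; group
    rw [this]; exact key_VV
  have s5 : Conn N (b * fx⁻¹ * ff) (g * ss K * ff) := by
    have : g * ss K * ff = b * fx⁻¹ * ff * tau ^ K := by
      rw [mul_assoc (b * fx⁻¹), ← tauz_f, hb]; unfold ss; group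
    rw [this]
    exact conn_mul (VV.zpow_mem tau_VV _)
  exact (((s1.trans s2).trans s3).trans s4).trans s5

lemma B_case {N : ℕ} {a M : ℤ} (hN : (N : ℤ) = 2 * M) {g v : FG} {ρ c : R2} {J K : ℤ}
    (hf : Form v⁻¹ 0 ρ c) (hJK : J ≤ K) (hρ : Sup ρ J K) (hJ : ρ.coeff J = 1) (hK : ρ.coeff K = 1)
    (hg : Bad g a M) (hgv : Bad (g * v) a M) (hq : (vc g).2.1.coeff (K + (a + M)) ≠ 0) :
    Conn N (g * ff) (g * ss K * ff) ∧ Bad (g * ss K) a M := by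
  have e := hf.vc (g := g)
  have hi := Iso_vc g
  have hi' := Iso_vc (g * v)
  obtain ⟨p1, r1, r2, r3⟩ := hg
  obtain ⟨p1', -⟩ := hgv
  have e1 := (Form_ssi K).vc (g := g)
  have hB : ∀ {i j}, (vc g).2.1.coeff i ≠ 0 → (vc g).2.1.coeff j ≠ 0 → j - i ≤ M - 1 :=
    fun h1 h2 => B_width hi p1 r1 h1 h2
  have r1' : Sup (vc (g * v)).2.2 a (a + M) := by rw [e]; exact r1
  have hB' : ∀ {i j}, (vc (g * v)).2.1.coeff i ≠ 0 → (vc (g * v)).2.1.coeff j ≠ 0 → j - i ≤ M - 1 :=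
    fun h1 h2 => B_width hi' p1' r1' h1 h2
  have eq' : (vc (g * v)).2.1 = (vc g).2.1 + ρ * (vc g).2.2 := by rw [e]
  rw [eq'] at hB'
  set p := (vc g).1
  set q := (vc g).2.1
  set r := (vc g).2.2
  have hpr := hρ.mul r1
  have hb := coeff_mul_bot hρ r1
  rw [hJ, r2, mul_one] at hb
  have hqs : Sup q (K + a + 1) (K + a + M) := by
    intro i h
    constructor
    · have := hB h hq; omega
    · by_contra hc
      have h' : (q + ρ * r).coeff i ≠ 0 := by
        rw [coeff_add', hpr.zero_of (by omega), add_zero]; exact h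
      rcases or_ne (x := q.coeff (J + a)) hb with h1 | h1
      · have := hB h1 h; omega
      · rw [← coeff_add'] at h1
        have := hB' h1 h'; omega
  have hp1 : Sup (p + T (-K) * ((1 + T 1) * q) + T 1 * r) (a + 1) (a + M) := by
    intro i h
    have h1 := (((p1.mono le_rfl (by omega : a + M ≤ a + M + 1)).add
      (hqs.t1.T_mul' (-K) (by omega) (by omega))).add (r1.T_mul' 1 (by omega) (by omega))) i h
    refine ⟨h1.1, ?_⟩
    by_contra hc
    have : i = a + M + 1 := by omega
    subst this
    apply h
    rw [coeff_add', coeff_add', coeff_T_mul, coeff_T_mul, p1.zero_of (by omega), t1_coeff,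
      hqs.zero_of (by omega), show a + M + 1 - -K - 1 = K + (a + M) by ring, zm2 hq,
      show a + M + 1 - 1 = a + M by ring, r3]
    decide
  refine ⟨B_step ⟨2 * a + 2, fun i h => ?_, fun i h => ?_⟩, ?_⟩
  · have := hp1 i h; omega
  · have := p1 i h; omega
  · unfold Bad
    rw [e1]
    refine ⟨?_, r1, r2, r3⟩
    convert hp1 using 1
    simp only [invert_T]
    ring

lemma B_core {N : ℕ} {a M : ℤ} (hN : (N : ℤ) = 2 * M) (n : ℕ) : ∀ (g v : FG) (ρ c : R2),
    ρ.coeff.support.card ≤ n → v ∈ VV → Form v⁻¹ 0 ρ c → Bad g a M → Bad (g * v) a M →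
    Conn N (g * ff) (g * v * ff) := by
  have hzero : ∀ (g v : FG) (c : R2), v ∈ VV → Form v⁻¹ 0 0 c → Bad g a M → Bad (g * v) a M →
      Conn N (g * ff) (g * v * ff) := by
    intro g v c hv hf hg hgv
    have hc : c = 0 := by
      by_contra hc
      obtain ⟨α, β, hαβ, hs, h1, h2⟩ := exists_ends hc
      have e : (vc (g * v)).1 = (vc g).1 + c * (vc g).2.2 := by rw [hf.vc]; simp
      obtain ⟨p1, r1, r2, r3⟩ := hg
      obtain ⟨p1', -⟩ := hgv
      rw [e] at p1'
      have hb := coeff_mul_bot hs r1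
      have ht := coeff_mul_top hs r1
      rw [h1, r2, mul_one] at hb
      rw [h2, r3, mul_one] at ht
      have k1 : a + 1 ≤ α + a := by
        rcases or_ne (x := (vc g).1.coeff (α + a)) hb with h | h
        · exact (p1 _ h).1
        · rw [← coeff_add'] at h; exact (p1' _ h).1
      have k2 : β + (a + M) ≤ a + M := by
        rcases or_ne (x := (vc g).1.coeff (β + (a + M))) ht with h | h
        · exact (p1 _ h).2
        · rw [← coeff_add'] at h; exact (p1' _ h).2
      omega
    subst hc
    have hn : v⁻¹ ∈ NN := lemmaV (a := 1) (VV.inv_mem hv) (by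
      rintro ⟨p, q, r⟩
      rw [hf]; simp)
    have hn : v ∈ NN := by simpa using NN.inv_mem hn
    apply conn_V
    have := NN_normal'.conj_mem v hn ff⁻¹
    apply NN_VV
    convert this using 1
    group
  induction n with
  | zero =>
    intro g v ρ c hn hv hf hg hgv
    have : ρ = 0 := by
      by_contra h
      have := Finset.card_pos.2 (coeff_ne h)
      omega
    subst this
    exact hzero g v c hv hf hg hgv
  | succ n ih =>
    intro g v ρ c hn hv hf hg hgv
    by_cases h0 : ρ = 0
    · subst h0
      exact hzero g v c hv hf hg hgv
    obtain ⟨J, K, hJK, hs, hJ, hK⟩ := exists_ends h0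
    have main : ∀ (g v : FG) (c : R2), v ∈ VV → Form v⁻¹ 0 ρ c → Bad g a M → Bad (g * v) a M →
        (vc g).2.1.coeff (K + (a + M)) ≠ 0 → Conn N (g * ff) (g * v * ff) := by
      intro g v c hv hf hg hgv hq
      obtain ⟨h1, h2⟩ := B_case hN hf hJK hs hJ hK hg hgv hq
      have hF : Form ((ss K)⁻¹ * v)⁻¹ 0 (T K + ρ) (1 + (1 + T 1) * invert ρ * T K + c) := by
        rw [_root_.mul_inv_rev, inv_inv]
        exact (hf.mul (Form_ss K)).congr (by simp) (by simp) (by simp)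
      have hgv' : g * v = g * ss K * ((ss K)⁻¹ * v) := by group
      have hcard : (T K + ρ).coeff.support.card ≤ n := by
        have hlt : (T K + ρ).coeff.support ⊂ ρ.coeff.support := by
          rw [Finset.ssubset_iff]
          refine ⟨K, ?_, ?_⟩
          · rw [Finsupp.mem_support_iff, not_not, coeff_add', hK]
            simp [T_apply]
            decide
          · intro i hi
            rw [Finset.mem_insert] at hi
            rw [Finsupp.mem_support_iff]
            by_cases hiK : i = K
            · rw [hiK, hK]; decide
            · rcases hi with hi | hi
              · exact absurd hi hiK
              · rw [Finsupp.mem_support_iff, coeff_add'] at hi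
                simpa [T_apply, Ne.symm hiK, hiK] using hi
        have := Finset.card_lt_card hlt
        omega
      have := ih (g * ss K) ((ss K)⁻¹ * v) _ _ hcard
        (VV.mul_mem (VV.inv_mem (ss_VV K)) hv) hF h2 (by rw [← hgv']; exact hgv)
      rw [← hgv'] at this
      exact h1.trans this
    have eq' : (vc (g * v)).2.1 = (vc g).2.1 + ρ * (vc g).2.2 := by rw [hf.vc]
    have ht := coeff_mul_top hs hg.2.1
    rw [hK, hg.2.2.2, mul_one] at ht
    rcases or_ne (x := (vc g).2.1.coeff (K + (a + M))) ht with h | h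
    · exact main g v c hv hf hg hgv h
    · rw [← coeff_add', ← eq'] at h
      have := main (g * v) v⁻¹ _ (VV.inv_mem hv) (hf.inv.congr neg_zero (by simp) rfl)
        hgv (by simpa using hg) h
      rw [mul_inv_cancel_right] at this
      exact this.symm

lemma not_low {N : ℕ} {p r : R2} (he : EdgeP (N + 1) p r) (h : ¬ lowP N r) :
    ∃ a M : ℤ, (N : ℤ) = 2 * M ∧ Sup p (a + 1) (a + M) ∧ Sup r a (a + M) ∧ r.coeff a = 1 ∧
      r.coeff (a + M) = 1 := by
  obtain ⟨l, hp, hr⟩ := he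
  push_cast at hp hr
  have hbot : ∃ i, r.coeff i ≠ 0 ∧ 2 * i + 1 = l := by
    by_contra! hc
    apply h
    refine ⟨l + 1, fun i hi => ?_⟩
    have := hr i hi; have := hc i hi; omega
  have htop : ∃ i, r.coeff i ≠ 0 ∧ 2 * i + 1 = l + N := by
    by_contra! hc
    apply h
    refine ⟨l, fun i hi => ?_⟩
    have := hr i hi; have := hc i hi; omega
  obtain ⟨i, hi, hil⟩ := hbot
  obtain ⟨j, hj, hjl⟩ := htop
  refine ⟨i, j - i, by omega, fun s hs => ?_, fun s hs => ?_, zm2 hi, ?_⟩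
  · have := hp s hs; omega
  · have := hr s hs; omega
  · rw [show i + (j - i) = j by ring]; exact zm2 hj

lemma low_VV {N : ℕ} {g v : FG} (hv : v ∈ VV) : low N (g * v) ↔ low N g := by
  obtain ⟨v', k, m, ρ, c, hv', hf, -, h⟩ := VV_shape hv
  unfold low
  rw [h, hf.vc]
  exact ⟨fun h => h.unscale, fun h => h.scale _⟩

lemma claimB {N : ℕ} {g v : FG} (hv : v ∈ VV) (he : Edge (N + 1) g) (he' : Edge (N + 1) (g * v))
    (hl : ¬ low N g) : Conn N (g * ff) (g * v * ff) := by
  obtain ⟨v', k, m, ρ, c, hv', hf, ⟨n, hn, hvn⟩, h⟩ := VV_shape hv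
  have he2 : Edge (N + 1) (g * v') := by
    unfold Edge at he' ⊢
    rw [h] at he'
    exact he'.unscale
  obtain ⟨a, M, hN, h1, h2, h3, h4⟩ := not_low he hl
  have er : (vc (g * v')).2.2 = (vc g).2.2 := by rw [hf.vc]
  have hl' : ¬ lowP N (vc (g * v')).2.2 := by rw [er]; exact hl
  obtain ⟨a', M', hN', h1', h2', h3', h4'⟩ := not_low he2 hl'
  have hM : M' = M := by omega
  subst hM
  have ha : a' = a := by
    rw [er] at h2' h3'
    have := h2' a (by rw [h3]; decide)
    have := h2 a' (by rw [h3']; decide)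
    omega
  subst ha
  have := B_core hN _ g v' ρ c le_rfl hv' hf ⟨h1, h2, h3, h4⟩ ⟨h1', h2', h3', h4'⟩
  refine this.trans (conn_V ?_)
  have e : (g * v' * ff)⁻¹ * (g * v * ff) = tau ^ (-k) * (ff⁻¹ * n * ff⁻¹⁻¹) := by
    rw [hvn]
    have : (g * v' * ff)⁻¹ * (g * (v' * tau ^ (-k) * n) * ff) =
      ff⁻¹ * (tau ^ (-k) * ff) * (ff⁻¹ * n * ff) := by group
    rw [this, tauz_f]; group
  rw [e]
  exact VV.mul_mem (VV.zpow_mem tau_VV _) (NN_VV (NN_normal'.conj_mem n hn ff⁻¹))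

lemma descend {N : ℕ} {b : FG} (h : Conn (N + 1) 1 b) :
    (low N b ∧ Conn N 1 b) ∨ (¬ low N b ∧ ∃ v ∈ VV, Edge (N + 1) (b * v) ∧ Conn N 1 (b * v * ff)) := by
  induction h with
  | refl =>
    left
    refine ⟨?_, Relation.ReflTransGen.refl⟩
    refine ⟨0, fun i hi => ?_⟩
    simp [vc] at hi
  | @tail b d _ hs ih =>
    rcases hs with hs | ⟨rfl, hs⟩
    · obtain ⟨u, rfl⟩ : ∃ u, d = b * u := ⟨b⁻¹ * d, by simp⟩
      rw [inv_mul_cancel_left] at hs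
      rcases ih with ⟨h1, h2⟩ | ⟨h1, v, hv, h2, h3⟩
      · exact Or.inl ⟨(low_VV hs).2 h1, h2.trans (conn_mul hs)⟩
      · refine Or.inr ⟨fun h => h1 ((low_VV hs).1 h), u⁻¹ * v, VV.mul_mem (VV.inv_mem hs) hv, ?_⟩
        have : b * u * (u⁻¹ * v) = b * v := by group
        rw [this]
        exact ⟨h2, h3⟩
    · rcases ih with ⟨h1, h2⟩ | ⟨h1, v, hv, h2, h3⟩
      · by_cases hl : low N (b * ff)
        · exact Or.inl ⟨hl, h2.trans (claimA hs h1 hl)⟩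
        · refine Or.inr ⟨hl, 1, VV.one_mem, ?_⟩
          rw [mul_one]
          exact ⟨hs.f, h2.trans (conn_ff' b)⟩
      · left
        constructor
        · obtain ⟨a, M, hN, k1, -⟩ := not_low hs h1
          unfold low
          rw [vc_f]
          refine ⟨2 * a + 2, fun i hi => ?_⟩
          have := k1 i hi
          omega
        · exact h3.trans (claimB hv hs h2 h1).symm

lemma conn_exists (g : FG) : ∀ h : FG, ∃ N, Conn N h (h * g) := by
  have stepf : ∀ h, ∃ N, Conn N h (h * ff) := fun h => by
    obtain ⟨N, hN⟩ := EdgeP.exists (vc h).1 (vc h).2.2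
    exact ⟨N, conn_f hN⟩
  have comb : ∀ {a b c : FG}, (∃ N, Conn N a b) → (∃ N, Conn N b c) → ∃ N, Conn N a c := by
    rintro a b c ⟨N, h⟩ ⟨N', h'⟩
    exact ⟨max N N', (h.mono (le_max_left _ _)).trans (h'.mono (le_max_right _ _))⟩
  induction g using FreeGroup.induction_on with
  | C1 => intro h; exact ⟨0, by rw [mul_one]; exact Relation.ReflTransGen.refl⟩
  | of i =>
    intro h
    fin_cases i
    · exact ⟨0, conn_mul x_VV⟩
    · show ∃ N, Conn N h (h * fy)
      rw [fy_eq, ← mul_assoc]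
      refine comb (b := h * ff⁻¹) ?_ ⟨0, conn_mul (VV.inv_mem x_VV)⟩
      obtain ⟨N, hN⟩ := stepf (h * ff⁻¹)
      rw [inv_mul_cancel_right] at hN
      exact ⟨N, hN.symm⟩
  | inv_of i _ =>
    intro h
    fin_cases i
    · exact ⟨0, conn_mul (VV.inv_mem x_VV)⟩
    · show ∃ N, Conn N h (h * fy⁻¹)
      rw [fyi_eq, ← mul_assoc]
      exact comb ⟨0, conn_mul x_VV⟩ (stepf _)
  | mul a b ha hb =>
    intro h
    rw [← mul_assoc]
    exact comb (ha h) (hb _)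

lemma conn_zero {b : FG} (h : Conn 0 1 b) : b ∈ VV := by
  induction h with
  | refl => exact VV.one_mem
  | @tail b d _ hs ih =>
    rcases hs with hs | ⟨-, hs⟩
    · have := VV.mul_mem ih hs
      rwa [mul_inv_cancel_left] at this
    · exfalso
      obtain ⟨l, h1, h2⟩ := hs
      have hp : (vc b).1 = 0 := by
        by_contra hc
        obtain ⟨i, -, -, -, hi, -⟩ := exists_ends hc
        have := h1 i (by rw [hi]; decide)
        simp at this; omega
      have hr : (vc b).2.2 = 0 := by
        by_contra hc
        obtain ⟨i, -, -, -, hi, -⟩ := exists_ends hc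
        have := h2 i (by rw [hi]; decide)
        simp at this; omega
      have hi := Iso_vc b
      unfold Iso at hi
      rw [hp, hr] at hi
      have hq : (vc b).2.1 = 0 := by
        have : (1 + T 1) * ((vc b).2.1 * invert (vc b).2.1) = 0 := by
          rw [← hi]; simp
        rcases mul_eq_zero.1 this with h | h
        · exact absurd h one_t_ne
        · rcases mul_eq_zero.1 h with h | h
          · exact h
          · have := congrArg invert h
            rwa [inv_inv', map_zero] at this
      exact vc_ne b (Prod.ext hp (Prod.ext hq hr))

lemma ker_le {g : FG} (h : FreeGroup.lift ![pp X, pp Y] g = 1) : g ∈ NN := by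
  obtain ⟨a, ha⟩ := scalar_of_ker (g := g⁻¹) (by rw [map_inv, h, inv_one])
  obtain ⟨b, hb⟩ := scalar_of_ker h
  have hr : (vc g).2.2 = 0 := by
    unfold vc; rw [ha]; simp
  have hlow : ∀ N, low N g := fun N => ⟨0, fun i hi => by rw [hr] at hi; exact absurd rfl hi⟩
  obtain ⟨N, hN⟩ := conn_exists g 1
  rw [one_mul] at hN
  have : ∀ N, Conn N 1 g → Conn 0 1 g := by
    intro N
    induction N with
    | zero => exact id
    | succ N ih =>
      intro h
      rcases descend h with ⟨-, h⟩ | ⟨h, -⟩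
      · exact ih h
      · exact absurd (hlow N) h
  exact lemmaV (conn_zero (this N hN)) hb


/-- **Theorem A.5.** `Q_{4,2}` is presented by generators `x, y` with relations
`1_o), 2_o), 1_b), 2_b), 3_b)`: the homomorphism from the free group on `x, y` sending
`x ↦ p(X)`, `y ↦ p(Y)` has range `Q_{4,2}` and kernel the normal closure of the
relators. -/
theorem statement14 :
    (FreeGroup.lift ![pp X, pp Y]).range = Q42 ∧
      (FreeGroup.lift ![pp X, pp Y]).ker = Subgroup.normalClosure q42RelsB := by
  constructor
  · rw [FreeGroup.range_lift_eq_closure]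
    congr 1
    ext z
    simp [Fin.exists_fin_two, eq_comm, or_comm]
  · apply le_antisymm
    · intro g hg
      exact ker_le hg
    · intro g hg
      obtain ⟨m, hm⟩ := NN_ScT hg
      exact ker_of_scalar hm
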